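/- Let (R, m) be a complete Noetherian local ring, M a finite R-module of Krull dimension n ≥ 2, and T a non-empty subset of Assh_R(M) with |T| = |Assh_R(M)| − 1 (i.e., the complement of T in Assh_R(M) is a singleton). Then there exists an ideal a of R such that Att_R(H^n_a(M)) = T. -/

import Mathlib

/-!
STATEMENT 7 (Dibaei–Jafari, Corollary 2.6): `n = dim M ≥ 2` and `T` a non-empty subset of
`Assh_R(M)` whose complement in `Assh_R(M)` is a singleton.  Then `T = Att_R(H^n_a(M))`
for some ideal `a`.
-/

open CategoryTheory

noncomputable section

universe u

/-- A prime ideal `p` is an *attached prime* of the `R`-module `N` if `p` is the annihilator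
of some quotient of `N`. -/
def attachedPrimes (R : Type u) [CommRing R] (N : Type u) [AddCommGroup N] [Module R N] :
    Set (Ideal R) :=
  { p | p.IsPrime ∧ ∃ K : Submodule R N, p = Module.annihilator R (N ⧸ K) }

/-- `Assh_R(M)`: the associated primes `p` of `M` with `dim (R ⧸ p) = dim M`, where the
dimension of `M` is recorded by the natural number `n`. -/
def assh (R : Type u) [CommRing R] (M : Type u) [AddCommGroup M] [Module R M] (n : ℕ) :
    Set (Ideal R) :=
  { p ∈ associatedPrimes R M | ringKrullDim (R ⧸ p) = (n : WithBot (WithTop ℕ)) }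

namespace LC
open Limits Opposite
variable {R : Type u} [CommRing R]

def Rep (K : ChainComplex (ModuleCat.{u} R)ᵒᵖ ℕ) (n : ℕ) (f : (K.X n).unop) (x : (K.homology n).unop) : Prop :=
  ∃ e : (K.opcycles n).unop, (K.pOpcycles n).unop e = f ∧ (K.homologyι n).unop e = x

lemma pinj (K : ChainComplex (ModuleCat.{u} R)ᵒᵖ ℕ) (n : ℕ) : Function.Injective (K.pOpcycles n).unop := by
  rw [← ModuleCat.mono_iff_injective]; infer_instance

lemma Rep.exists_rep {K : ChainComplex (ModuleCat.{u} R)ᵒᵖ ℕ} {n : ℕ} (x : (K.homology n).unop) :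
    ∃ f, Rep K n f x := by
  have : Function.Surjective (K.homologyι n).unop := by
    rw [← ModuleCat.epi_iff_surjective]; infer_instance
  obtain ⟨e, he⟩ := this x
  exact ⟨_, e, rfl, he⟩

lemma Rep.cocycle {K : ChainComplex (ModuleCat.{u} R)ᵒᵖ ℕ} {n : ℕ} {f x} (h : Rep K n f x) :
    (K.d (n+1) n).unop f = 0 := by
  obtain ⟨e, rfl, -⟩ := h
  have h : (K.pOpcycles n).unop ≫ (K.d (n+1) n).unop = 0 := by
    rw [← unop_comp, K.d_pOpcycles]; rfl
  exact congr($h e)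

lemma Rep.exists_of_cocycle (K : ChainComplex (ModuleCat.{u} R)ᵒᵖ ℕ) {n : ℕ} (f : (K.X n).unop)
    (h : (K.d (n+1) n).unop f = 0) : ∃ x, Rep K n f x := by
  let φ : ModuleCat.of R R ⟶ (K.X n).unop := ModuleCat.ofHom (LinearMap.toSpanSingleton R _ f)
  have hφ : φ ≫ (K.d (n+1) n).unop = 0 := by
    ext; simpa [φ] using h
  let ψ : K.opcycles n ⟶ op (ModuleCat.of R R) := K.descOpcycles φ.op (n+1) (by simp) (by
    apply Quiver.Hom.unop_inj; exact hφ)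
  have hψ : ψ.unop ≫ (K.pOpcycles n).unop = φ := by
    rw [← unop_comp, K.p_descOpcycles]; rfl
  refine ⟨_, ψ.unop (1:R), ?_, rfl⟩
  have := congr($hψ (1:R))
  simpa [φ] using this

lemma Rep.unique {K : ChainComplex (ModuleCat.{u} R)ᵒᵖ ℕ} {n : ℕ} {f x y} (h : Rep K n f x) 
    (h' : Rep K n f y) : x = y := by
  obtain ⟨e, rfl, rfl⟩ := h
  obtain ⟨e', h1, rfl⟩ := h'
  rw [pinj K n h1]

lemma Rep.add {K : ChainComplex (ModuleCat.{u} R)ᵒᵖ ℕ} {n : ℕ} {f g x y} (h : Rep K n f x) 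
    (h' : Rep K n g y) : Rep K n (f + g) (x + y) := by
  obtain ⟨e, rfl, rfl⟩ := h
  obtain ⟨e', rfl, rfl⟩ := h'
  exact ⟨e + e', map_add _ _ _, map_add _ _ _⟩

lemma Rep.smul {K : ChainComplex (ModuleCat.{u} R)ᵒᵖ ℕ} {n : ℕ} {f x} (r : R) (h : Rep K n f x) :
    Rep K n (r • f) (r • x) := by
  obtain ⟨e, rfl, rfl⟩ := h
  exact ⟨r • e, map_smul _ _ _, map_smul _ _ _⟩

lemma Rep.map {K L : ChainComplex (ModuleCat.{u} R)ᵒᵖ ℕ} (φ : K ⟶ L) {n : ℕ} {f x} (h : Rep L n f x) :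
    Rep K n ((φ.f n).unop f) ((HomologicalComplex.homologyMap φ n).unop x) := by
  obtain ⟨e, rfl, rfl⟩ := h
  refine ⟨(HomologicalComplex.opcyclesMap φ n).unop e, ?_, ?_⟩
  · have : (HomologicalComplex.opcyclesMap φ n).unop ≫ (K.pOpcycles n).unop 
      = (L.pOpcycles n).unop ≫ (φ.f n).unop := by
      rw [← unop_comp, ← unop_comp, HomologicalComplex.p_opcyclesMap]
    exact congr($this e)
  · have : (HomologicalComplex.opcyclesMap φ n).unop ≫ (K.homologyι n).unop 
      = (L.homologyι n).unop ≫ (HomologicalComplex.homologyMap φ n).unop := by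
      rw [← unop_comp, ← unop_comp, HomologicalComplex.homologyι_naturality]
    exact congr($this e)

lemma Rep.ker {K : ChainComplex (ModuleCat.{u} R)ᵒᵖ ℕ} {n : ℕ} (e : (K.opcycles n).unop) :
   (K.homologyι n).unop e = 0 ↔ ∃ g, (K.fromOpcycles n ((ComplexShape.down ℕ).next n)).unop g = e := by
  have ex : (ShortComplex.mk (K.homologyι n) (K.fromOpcycles n ((ComplexShape.down ℕ).next n)) (by simp)).Exact :=
    ShortComplex.exact_of_f_is_kernel _ (K.homologyIsKernel n _ rfl)
  have := (ShortComplex.ShortExact.moduleCat_exact_iff_function_exact _).1 ex.unop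
  exact this e

lemma Rep.zero_iff {K : ChainComplex (ModuleCat.{u} R)ᵒᵖ ℕ} {n : ℕ} {f x} (h : Rep K n f x) :
    x = 0 ↔ ∃ g, (K.d n ((ComplexShape.down ℕ).next n)).unop g = f := by
  obtain ⟨e, rfl, rfl⟩ := h
  rw [Rep.ker]
  have : (K.fromOpcycles n ((ComplexShape.down ℕ).next n)).unop ≫ (K.pOpcycles n).unop 
     = (K.d n ((ComplexShape.down ℕ).next n)).unop := by
    rw [← unop_comp, K.p_fromOpcycles]
  rw [← this]
  constructor
  · rintro ⟨g, rfl⟩; exact ⟨g, rfl⟩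
  · rintro ⟨g, hg⟩; exact ⟨g, pinj K n hg⟩

abbrev YF (Y : ModuleCat.{u} R) : ModuleCat.{u} R ⥤ (ModuleCat.{u} R)ᵒᵖ :=
  ((linearYoneda R (ModuleCat.{u} R)).obj Y).rightOp

abbrev OE (X Y : ModuleCat.{u} R) (n : ℕ) : ModuleCat.{u} R :=
  ((_root_.Ext R (ModuleCat.{u} R) n).obj (op X)).obj Y

def Cls {X : ModuleCat.{u} R} (P : ProjectiveResolution X) {Y : ModuleCat.{u} R} {n : ℕ}
    (f : P.complex.X n ⟶ Y) (x : OE X Y n) : Prop :=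
  Rep (((YF Y).mapHomologicalComplex _).obj P.complex) n f ((P.isoLeftDerivedObj (YF Y) n).inv.unop x)

section
variable {X Y : ModuleCat.{u} R} {P : ProjectiveResolution X} {n : ℕ}

lemma isoInv_bij (P : ProjectiveResolution X) (Y : ModuleCat.{u} R) (n : ℕ) :
    Function.Bijective (P.isoLeftDerivedObj (YF Y) n).inv.unop :=
  ConcreteCategory.bijective_of_isIso _

lemma Cls.exists_rep (P : ProjectiveResolution X) (x : OE X Y n) :
    ∃ f : P.complex.X n ⟶ Y, Cls P f x :=
  Rep.exists_rep (K := ((YF Y).mapHomologicalComplex _).obj P.complex) (n := n)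
    ((P.isoLeftDerivedObj (YF Y) n).inv.unop x)

lemma Cls.cocycle {f : P.complex.X n ⟶ Y} {x : OE X Y n} (h : Cls P f x) :
    P.complex.d (n+1) n ≫ f = 0 := Rep.cocycle h

lemma Cls.exists_of_cocycle {f : P.complex.X n ⟶ Y} (h : P.complex.d (n+1) n ≫ f = 0) :
    ∃ x, Cls P f x := by
  obtain ⟨x, hx⟩ := Rep.exists_of_cocycle (((YF Y).mapHomologicalComplex _).obj P.complex) f h
  obtain ⟨y, rfl⟩ := (isoInv_bij P Y n).2 x
  exact ⟨y, hx⟩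

lemma Cls.unique {f : P.complex.X n ⟶ Y} {x y : OE X Y n} (h : Cls P f x) (h' : Cls P f y) :
    x = y := (isoInv_bij P Y n).1 (Rep.unique h h')

lemma Cls.add {f g : P.complex.X n ⟶ Y} {x y : OE X Y n} (h : Cls P f x) (h' : Cls P g y) :
    Cls P (f + g) (x + y) := by
  have := Rep.add h h'
  have e := map_add (P.isoLeftDerivedObj (YF Y) n).inv.unop.hom x y
  unfold Cls
  erw [e]
  exact this

lemma Cls.smul {f : P.complex.X n ⟶ Y} {x : OE X Y n} (r : R) (h : Cls P f x) :
    Cls P (r • f) (r • x) := by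
  have := Rep.smul r h
  have e := map_smul (P.isoLeftDerivedObj (YF Y) n).inv.unop.hom r x
  unfold Cls
  erw [e]
  exact this

lemma Cls.zero_iff {f : P.complex.X n ⟶ Y} {x : OE X Y n} (h : Cls P f x) :
    x = 0 ↔ ∃ g : P.complex.X ((ComplexShape.down ℕ).next n) ⟶ Y, 
      P.complex.d n ((ComplexShape.down ℕ).next n) ≫ g = f := by
  have := Rep.zero_iff h
  refine Iff.trans ⟨?_, ?_⟩ this
  · rintro rfl; exact map_zero _
  · intro h; apply (isoInv_bij P Y n).1; rw [h]; exact (map_zero _).symm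

lemma Cls.precomp {X' : ModuleCat.{u} R} {P' : ProjectiveResolution X'} {g : X' ⟶ X}
    (φ : ProjectiveResolution.Hom P' P g) {f : P.complex.X n ⟶ Y} {x : OE X Y n} (h : Cls P f x) :
    Cls P' (φ.hom.f n ≫ f) ((((_root_.Ext R (ModuleCat.{u} R) n).map g.op).app Y) x) := by
  have := Rep.map (((YF Y).mapHomologicalComplex _).map φ.hom) h
  have e := P'.isoLeftDerivedObj_inv_naturality g P φ.hom φ.hom_f_zero_comp_π_f_zero (YF Y) n
  have e2 := congr(Quiver.Hom.unop $e x)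
  unfold Cls
  erw [e2]
  exact this

lemma Cls.postcomp {Y' : ModuleCat.{u} R} (g : Y ⟶ Y')
    {f : P.complex.X n ⟶ Y} {x : OE X Y n} (h : Cls P f x) :
    Cls P (f ≫ g) (((_root_.Ext R (ModuleCat.{u} R) n).obj (op X)).map g x) := by
  let α : YF Y' ⟶ YF Y := NatTrans.rightOp ((linearYoneda R (ModuleCat.{u} R)).map g)
  have := Rep.map ((NatTrans.mapHomologicalComplex α _).app P.complex) h
  have e := P.leftDerived_app_eq α n
  have e2 := congr((P.isoLeftDerivedObj (YF Y') n).inv ≫ $e)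
  rw [Iso.inv_hom_id_assoc] at e2
  have e3 := congr(Quiver.Hom.unop $e2 x)
  unfold Cls
  erw [e3]
  exact this
end

abbrev AE (X Y : ModuleCat.{u} R) (n : ℕ) : Type u := Abelian.Ext.{u} X Y n

section
variable {X Y : ModuleCat.{u} R} {P : ProjectiveResolution X} {n : ℕ}

lemma Cls.sub {f g : P.complex.X n ⟶ Y} {x y : OE X Y n} (h : Cls P f x) (h' : Cls P g y) :
    Cls P (f - g) (x - y) := by
  have := h.add (h'.smul (-1))
  rwa [neg_one_smul, neg_one_smul, ← sub_eq_add_neg, ← sub_eq_add_neg] at this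

open CochainComplex HomComplex in
lemma extMk_zero_iff (f : P.complex.X n ⟶ Y) (hf : P.complex.d (n+1) n ≫ f = 0) :
    (P.extMk f (n+1) rfl hf : AE X Y n) = 0 ↔
      ∃ g : P.complex.X ((ComplexShape.down ℕ).next n) ⟶ Y, 
      P.complex.d n ((ComplexShape.down ℕ).next n) ≫ g = f := by
  cases n with
  | succ k =>
    rw [ChainComplex.next_nat_succ]
    exact P.extMk_eq_zero_iff f _ rfl hf k rfl
  | zero =>
    rw [ChainComplex.next_nat_zero]
    have h0 : P.complex.d 0 0 = 0 := P.complex.shape _ _ (by simp)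
    rw [h0]
    simp only [zero_comp, exists_const]
    constructor
    · intro h
      simp only [← P.extEquivCohomologyClass.apply_eq_iff_eq,
        ProjectiveResolution.extEquivCohomologyClass_extMk, ProjectiveResolution.extEquivCohomologyClass_zero,
        CohomologyClass.mk_eq_zero_iff] at h
      rw [Cocycle.toSingleMk_mem_coboundaries_iff _ _ _ _ _ 1 (by simp)] at h
      obtain ⟨g, hg⟩ := h
      have z : P.cochainComplex.d (-((0:ℕ):ℤ)) 1 = 0 := by
        apply (P.cochainComplex.isZero_of_isStrictlyLE 0 1).eq_of_tgt
      rw [z, zero_comp] at hg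
      exact (by simpa using hg.symm : f = 0).symm
    · rintro rfl; simp

lemma extMk_smul (r : R) (f : P.complex.X n ⟶ Y) (hf : P.complex.d (n+1) n ≫ f = 0) :
    (P.extMk (r • f) (n+1) rfl (by simp [hf]) : AE X Y n) = r • P.extMk f (n+1) rfl hf := by
  rw [Abelian.Ext.smul_eq_comp_mk₀, P.extMk_comp_mk₀]
  congr 1

end

section
variable (X Y : ModuleCat.{u} R) (n : ℕ)

lemma toOE_ex (α : AE X Y n) : ∃ (x : OE X Y n) (f : (projectiveResolution X).complex.X n ⟶ Y)
    (hf : (projectiveResolution X).complex.d (n+1) n ≫ f = 0), 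
    (projectiveResolution X).extMk f (n+1) rfl hf = α ∧ Cls _ f x := by
  obtain ⟨f, hf, h⟩ := (projectiveResolution X).extMk_surjective α (n+1) rfl
  obtain ⟨x, hx⟩ := Cls.exists_of_cocycle hf
  exact ⟨x, f, hf, h, hx⟩

variable {X Y n} in
lemma toOE_aux {x : OE X Y n} {f : (projectiveResolution X).complex.X n ⟶ Y} (h : Cls _ f x) :
    x = (toOE_ex X Y n ((projectiveResolution X).extMk f (n+1) rfl h.cocycle)).choose := by
  obtain ⟨f', hf', e, hx⟩ := (toOE_ex X Y n ((projectiveResolution X).extMk f (n+1) rfl h.cocycle)).choose_spec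
  rw [← sub_eq_zero, (h.sub hx).zero_iff, ← extMk_zero_iff _ (h.sub hx).cocycle,
   ← ProjectiveResolution.sub_extMk _ _ _ _ _ h.cocycle hf', e, sub_self]
  
def toOE : AE X Y n →ₗ[R] OE X Y n where
  toFun α := (toOE_ex X Y n α).choose
  map_add' α β := by
    obtain ⟨x, f, hf, rfl, hx⟩ := toOE_ex X Y n α
    obtain ⟨y, g, hg, rfl, hy⟩ := toOE_ex X Y n β
    rw [← toOE_aux hx, ← toOE_aux hy, toOE_aux (hx.add hy)]
    simp only [ProjectiveResolution.add_extMk]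
  map_smul' r α := by
    obtain ⟨x, f, hf, rfl, hx⟩ := toOE_ex X Y n α
    rw [← toOE_aux hx, RingHom.id_apply, toOE_aux (hx.smul r)]
    simp only [extMk_smul _ _ hf]

variable {X Y n}

lemma toOE_extMk {x : OE X Y n} {f : (projectiveResolution X).complex.X n ⟶ Y} (h : Cls _ f x) :
    toOE X Y n ((projectiveResolution X).extMk f (n+1) rfl h.cocycle) = x := (toOE_aux h).symm

lemma toOE_bij : Function.Bijective (toOE X Y n) := by
  constructor
  · rw [injective_iff_map_eq_zero]
    intro α h
    obtain ⟨x, f, hf, rfl, hx⟩ := toOE_ex X Y n α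
    rw [toOE_extMk hx, hx.zero_iff] at h
    rwa [extMk_zero_iff]
  · intro x
    obtain ⟨f, hf⟩ := Cls.exists_rep (projectiveResolution X) x
    exact ⟨_, toOE_extMk hf⟩

lemma toOE_postcomp {Y' : ModuleCat.{u} R} (g : Y ⟶ Y') (α : AE X Y n) :
    toOE X Y' n (α.comp (Abelian.Ext.mk₀ g) (add_zero _)) = 
      ((_root_.Ext R (ModuleCat.{u} R) n).obj (op X)).map g (toOE X Y n α) := by
  obtain ⟨x, f, hf, rfl, hx⟩ := toOE_ex X Y n α
  rw [toOE_extMk hx, ProjectiveResolution.extMk_comp_mk₀, toOE_extMk (hx.postcomp g)]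

lemma toOE_precomp {X' : ModuleCat.{u} R} (g : X' ⟶ X) (α : AE X Y n) :
    toOE X' Y n ((Abelian.Ext.mk₀ g).comp α (zero_add _)) = 
      (((_root_.Ext R (ModuleCat.{u} R) n).map g.op).app Y) (toOE X Y n α) := by
  obtain ⟨x, f, hf, rfl, hx⟩ := toOE_ex X Y n α
  let φ : ProjectiveResolution.Hom (projectiveResolution X') (projectiveResolution X) g :=
    ⟨ProjectiveResolution.lift g _ _, ProjectiveResolution.lift_commutes_zero _ _ _⟩
  rw [toOE_extMk hx, ProjectiveResolution.mk₀_comp_extMk _ _ _ _ φ, toOE_extMk (hx.precomp φ)]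
end


section
open localCohomology
variable (a : Ideal R)

abbrev Q (t : ℕ) : ModuleCat.{u} R := ModuleCat.of R (R ⧸ a ^ t)

def tr {s t : ℕ} (h : t ≤ s) : Q a s ⟶ Q a t :=
  ModuleCat.ofHom <| Submodule.mapQ _ _ LinearMap.id (Ideal.pow_le_pow_right h)

lemma tr_comp {s t r : ℕ} (h : t ≤ s) (h' : r ≤ t) : tr a h ≫ tr a h' = tr a (h'.trans h) := by
  ext; rfl

variable {a} in
def res {M : ModuleCat.{u} R} {n : ℕ} {s t : ℕ} (h : t ≤ s) (α : AE (Q a t) M n) : AE (Q a s) M n :=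
  (Abelian.Ext.mk₀ (tr a h)).comp α (zero_add _)

abbrev H (n : ℕ) (M : ModuleCat.{u} R) : ModuleCat.{u} R := (localCohomology a n).obj M

abbrev Hm (n : ℕ) {M N : ModuleCat.{u} R} (f : M ⟶ N) : H a n M →ₗ[R] H a n N := 
  ((localCohomology a n).map f).hom

def dg (n : ℕ) (M : ModuleCat.{u} R) : (ℕᵒᵖ)ᵒᵖ ⥤ ModuleCat.{u} R := 
  (diagram (idealPowersDiagram a) n) ⋙ (evaluation _ _).obj M

def cc (n : ℕ) (M : ModuleCat.{u} R) : Cocone (dg a n M) := 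
  ((evaluation _ _).obj M).mapCocone (colimit.cocone (diagram (idealPowersDiagram a) n))

def ccl (n : ℕ) (M : ModuleCat.{u} R) : IsColimit (cc a n M) := 
  isColimitOfPreserves ((evaluation _ _).obj M) (colimit.isColimit (diagram (idealPowersDiagram a) n))

def inc (n : ℕ) (M : ModuleCat.{u} R) (t : ℕ) : AE (Q a t) M n →ₗ[R] H a n M :=
  ((cc a n M).ι.app (op (op t))).hom ∘ₗ toOE (Q a t) M n

variable {a} {n : ℕ} {M N : ModuleCat.{u} R}

instance presShape : PreservesColimitsOfShape (ℕᵒᵖ)ᵒᵖ (forget (ModuleCat.{u} R)) := by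
  have : PreservesFilteredColimitsOfSize.{0, 0} (forget (ModuleCat.{u} R)) :=
    preservesFilteredColimitsOfSize_shrink.{0, u, 0, u} _
  exact this.preserves_filtered_colimits _

lemma inc_surj (x : H a n M) : ∃ t α, inc a n M t α = x := by
  obtain ⟨j, y, hy⟩ := Concrete.isColimit_exists_rep (dg a n M) (ccl a n M) x
  obtain ⟨α, rfl⟩ := toOE_bij.2 y
  exact ⟨_, α, hy⟩

lemma dg_map {s t : ℕ} (h : t ≤ s) (α : AE (Q a t) M n) (w : op (op t) ⟶ op (op s)) :
   (dg a n M).map w (toOE (Q a t) M n α) = toOE (Q a s) M n (res h α) := 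
  (toOE_precomp _ _).symm

lemma inc_res {s t : ℕ} (h : t ≤ s) (α : AE (Q a t) M n) : inc a n M s (res h α) = inc a n M t α := by
  let w : op (op t) ⟶ op (op s) := (homOfLE h).op.op
  have := congr($((cc a n M).w w) (toOE (Q a t) M n α))
  refine Eq.trans ?_ this
  exact congrArg ((cc a n M).ι.app (op (op s))).hom (dg_map h α w).symm

lemma inc_zero {t : ℕ} {α : AE (Q a t) M n} (h : inc a n M t α = 0) : ∃ s, ∃ h : t ≤ s, res h α = 0 := by
  have h' : (cc a n M).ι.app (op (op t)) (toOE (Q a t) M n α) = (cc a n M).ι.app (op (op t)) 0 := by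
    refine Eq.trans h (map_zero _).symm
  obtain ⟨j, w, e⟩ := (IsColimit.eq_iff' (ccl a n M) (i := op (op t)) (toOE (Q a t) M n α) 0).1 h'
  have hle : t ≤ j.unop.unop := leOfHom w.unop.unop
  refine ⟨j.unop.unop, hle, ?_⟩
  have e2 := (dg_map hle α w).symm.trans (e.trans (map_zero _))
  exact toOE_bij.1 (e2.trans (map_zero _).symm)

lemma inc_map (f : M ⟶ N) {t : ℕ} (α : AE (Q a t) M n) : 
   Hm a n f (inc a n M t α) = inc a n N t (α.comp (Abelian.Ext.mk₀ f) (add_zero _)) := by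
  have := congr($((colimit.ι (diagram (idealPowersDiagram a) n) (op (op t))).naturality f) (toOE _ _ _ α))
  refine this.symm.trans ?_
  exact congrArg ((cc a n N).ι.app (op (op t))).hom (toOE_postcomp f α).symm
end


section
variable {a : Ideal R} {n : ℕ} {M N : ModuleCat.{u} R}

lemma res_zero {s t : ℕ} (h : t ≤ s) : res h (0 : AE (Q a t) M n) = 0 := by simp [res]

lemma res_res {s t r : ℕ} (h : t ≤ s) (h' : r ≤ t) (α : AE (Q a r) M n) : 
    res h (res h' α) = res (h'.trans h) α := by
  simp only [res]
  rw [Abelian.Ext.mk₀_comp_mk₀_assoc, tr_comp]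

lemma res_comp {s t m k : ℕ} (h : t ≤ s) (α : AE (Q a t) M n) (β : AE M N m) (e : n + m = k) :
    (res h α).comp β e = res h (α.comp β e) := by
  simp only [res]
  rw [Abelian.Ext.comp_assoc]
  omega

lemma inc_eq {s t : ℕ} {α : AE (Q a t) M n} {β : AE (Q a s) M n} (h : inc a n M t α = inc a n M s β) :
    ∃ r, ∃ (h1 : t ≤ r) (h2 : s ≤ r), res h1 α = res h2 β := by
  have h1 : t ≤ max t s := le_max_left _ _
  have h2 : s ≤ max t s := le_max_right _ _
  rw [← inc_res h1, ← inc_res h2, ← sub_eq_zero, ← map_sub] at h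
  obtain ⟨r, hr, e⟩ := inc_zero h
  refine ⟨r, h1.trans hr, h2.trans hr, ?_⟩
  rw [← res_res hr h1, ← res_res hr h2, ← sub_eq_zero, ← e]
  simp [res, sub_eq_add_neg]

def descH {V : Type*} [AddCommGroup V] [Module R V] (φ : ∀ t, AE (Q a t) M n →ₗ[R] V) 
    (hφ : ∀ {s t : ℕ} (h : t ≤ s) (α), φ s (res h α) = φ t α) : H a n M →ₗ[R] V :=
  have key : ∀ {s t : ℕ} {α : AE (Q a t) M n} {β : AE (Q a s) M n}, inc a n M t α = inc a n M s β → 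
      φ t α = φ s β := fun h => by
    obtain ⟨r, h1, h2, e⟩ := inc_eq h
    rw [← hφ h1, ← hφ h2, e]
  { toFun := fun x => φ _ (inc_surj x).choose_spec.choose
    map_add' := fun x y => by
      have hx := (inc_surj x).choose_spec.choose_spec
      have hy := (inc_surj y).choose_spec.choose_spec
      generalize (inc_surj x).choose_spec.choose = α at *
      generalize (inc_surj y).choose_spec.choose = β at *
      rw [← hφ (le_max_left _ (inc_surj y).choose) α, ← hφ (le_max_right (inc_surj x).choose _) β, ← map_add]
      apply key
      rw [(inc_surj (x + y)).choose_spec.choose_spec, map_add, inc_res, inc_res, hx, hy]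
    map_smul' := fun r x => by
      rw [RingHom.id_apply, ← map_smul]
      apply key
      rw [(inc_surj (r • x)).choose_spec.choose_spec, map_smul, (inc_surj x).choose_spec.choose_spec] }

lemma descH_inc {V : Type*} [AddCommGroup V] [Module R V] (φ : ∀ t, AE (Q a t) M n →ₗ[R] V) 
    (hφ : ∀ {s t : ℕ} (h : t ≤ s) (α), φ s (res h α) = φ t α) {t : ℕ} (α : AE (Q a t) M n) : 
    descH φ hφ (inc a n M t α) = φ t α := by
  obtain ⟨r, h1, h2, e⟩ := inc_eq (inc_surj (inc a n M t α)).choose_spec.choose_spec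
  rw [← hφ h2, ← e, hφ h1]; rfl

section
variable {S : ShortComplex (ModuleCat.{u} R)} (hS : S.ShortExact)

include hS in
lemma H_ex2 (x : H a n S.X₂) (hx : Hm a n S.g x = 0) : ∃ y, Hm a n S.f y = x := by
  obtain ⟨t, α, rfl⟩ := inc_surj x
  rw [inc_map] at hx
  obtain ⟨s, h, e⟩ := inc_zero hx
  rw [← res_comp] at e
  obtain ⟨β, hβ⟩ := Abelian.Ext.covariant_sequence_exact₂ _ hS _ e
  exact ⟨inc _ _ _ _ β, by rw [inc_map, hβ, inc_res]⟩

lemma δ_aux {s t : ℕ} (h : t ≤ s) (α : AE (Q a t) S.X₃ n) :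
    (inc a (n + 1) S.X₁ s ∘ₗ hS.extClass.postcompOfLinear R (Q a s) rfl) (res h α) =
      (inc a (n + 1) S.X₁ t ∘ₗ hS.extClass.postcompOfLinear R (Q a t) rfl) α := by
  simp only [LinearMap.comp_apply, LinearMap.flip_apply, Abelian.Ext.bilinearCompOfLinear_apply_apply]
  rw [res_comp, inc_res]

variable (a n) in
def δ : H a n S.X₃ →ₗ[R] H a (n+1) S.X₁ :=
  descH (fun t => inc a (n+1) S.X₁ t ∘ₗ Abelian.Ext.postcompOfLinear hS.extClass R (Q a t) rfl)
    (δ_aux hS)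

lemma δ_inc {t : ℕ} (α : AE (Q a t) S.X₃ n) : 
    δ a n hS (inc _ _ _ _ α) = inc a (n+1) S.X₁ t (α.comp hS.extClass rfl) := by
  exact descH_inc _ (δ_aux hS) α

lemma H_ex3 (x : H a n S.X₃) (hx : δ a n hS x = 0) : ∃ y, Hm a n S.g y = x := by
  obtain ⟨t, α, rfl⟩ := inc_surj x
  rw [δ_inc] at hx
  obtain ⟨s, h, e⟩ := inc_zero hx
  rw [← res_comp] at e
  obtain ⟨β, hβ⟩ := Abelian.Ext.covariant_sequence_exact₃ _ hS _ _ e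
  exact ⟨inc _ _ _ _ β, by rw [inc_map, hβ, inc_res]⟩

lemma H_ex1 (x : H a (n+1) S.X₁) (hx : Hm a (n+1) S.f x = 0) : ∃ y, δ a n hS y = x := by
  obtain ⟨t, α, rfl⟩ := inc_surj x
  rw [inc_map] at hx
  obtain ⟨s, h, e⟩ := inc_zero hx
  rw [← res_comp] at e
  obtain ⟨β, hβ⟩ := Abelian.Ext.covariant_sequence_exact₁ _ hS _ e rfl
  exact ⟨inc _ _ _ _ β, by rw [δ_inc, hβ, inc_res]⟩

include hS in
lemma H_ex0 (x : H a 0 S.X₁) (hx : Hm a 0 S.f x = 0) : x = 0 := by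
  obtain ⟨t, α, rfl⟩ := inc_surj x
  rw [inc_map] at hx
  obtain ⟨s, h, e⟩ := inc_zero hx
  rw [← res_comp] at e
  have := hS.mono_f
  have := Abelian.Ext.postcomp_mk₀_injective_of_mono _ S.f (a₁ := res h α) (a₂ := 0) (by
    simpa using e)
  rw [← inc_res h, this, map_zero]
end

lemma Hm_smul (r : R) (x : H a n M) : Hm a n (r • 𝟙 M) x = r • x := by
  obtain ⟨t, α, rfl⟩ := inc_surj x
  rw [inc_map, ← Abelian.Ext.smul_eq_comp_mk₀, map_smul]

lemma Hm_comp {L : ModuleCat.{u} R} (f : M ⟶ N) (g : N ⟶ L) (x : H a n M) : 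
    Hm a n (f ≫ g) x = Hm a n g (Hm a n f x) := by
  simp [Hm]

lemma Hm_add (f g : M ⟶ N) (x : H a n M) : 
    Hm a n (f + g) x = Hm a n f x + Hm a n g x := by
  obtain ⟨t, α, rfl⟩ := inc_surj x
  simp only [inc_map, Abelian.Ext.mk₀_add, Abelian.Ext.comp_add, map_add]

lemma H_torsion (x : H a n M) : ∃ t, ∀ r ∈ a ^ t, r • x = 0 := by
  obtain ⟨t, α, rfl⟩ := inc_surj x
  refine ⟨t, fun r hr => ?_⟩
  have : r • α = 0 := by
    have h0 : r • 𝟙 (Q a t) = 0 := by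
      ext
      change Ideal.Quotient.mk (a ^ t) (r * 1) = 0
      rw [Ideal.Quotient.eq_zero_iff_mem, mul_one]
      exact hr
    rw [← Abelian.Ext.mk₀_id_comp α, ← Abelian.Ext.smul_comp, ← Abelian.Ext.mk₀_smul, h0]
    simp
  rw [← map_smul, this, map_zero]

lemma H_inj [Injective M] (x : H a (n+1) M) : x = 0 := by
  obtain ⟨t, α, rfl⟩ := inc_surj x
  rw [α.eq_zero_of_injective, map_zero]

lemma lin0 {X Y : ModuleCat.{u} R} (f : X ⟶ Y) : 
    Abelian.Ext.linearEquiv₀ (R := R) (Abelian.Ext.mk₀ f) = f := 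
  (Abelian.Ext.linearEquiv₀ (R := R)).apply_symm_apply f

variable (a M) in
def ev0 (t : ℕ) : AE (Q a t) M 0 →ₗ[R] M :=
  { toFun := fun α => (Abelian.Ext.linearEquiv₀ (R := R) α).hom (Ideal.Quotient.mk (a ^ t) 1)
    map_add' := fun α β => by simp
    map_smul' := fun r α => by simp }

lemma ev0_mk {t : ℕ} (f : Q a t ⟶ M) : ev0 a M t (Abelian.Ext.mk₀ f) = f (Ideal.Quotient.mk (a ^ t) 1) := 
  congr(ModuleCat.Hom.hom $(lin0 f) (Ideal.Quotient.mk (a ^ t) 1))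

lemma ev_aux {s t : ℕ} (h : t ≤ s) (α : AE (Q a t) M 0) : ev0 a M s (res h α) = ev0 a M t α := by
  obtain ⟨f, rfl⟩ := Abelian.Ext.mk₀_bijective _ _ |>.2 α
  rw [res, Abelian.Ext.mk₀_comp_mk₀, ev0_mk, ev0_mk]
  rfl

variable (a M) in
def ev : H a 0 M →ₗ[R] M := descH (ev0 a M) ev_aux

lemma ev_inc {t : ℕ} (f : Q a t ⟶ M) : 
    ev a M (inc _ _ _ _ (Abelian.Ext.mk₀ f)) = f (Ideal.Quotient.mk (a ^ t) 1) := 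
  (descH_inc _ ev_aux _).trans (ev0_mk f)

lemma ev_map (g : M ⟶ N) (x : H a 0 M) : ev a N (Hm a 0 g x) = g (ev a M x) := by
  obtain ⟨t, α, rfl⟩ := inc_surj x
  obtain ⟨f, rfl⟩ := Abelian.Ext.mk₀_bijective _ _ |>.2 α
  rw [inc_map, Abelian.Ext.mk₀_comp_mk₀, ev_inc, ev_inc]; rfl

lemma ev_inj : Function.Injective (ev a M) := by
  rw [injective_iff_map_eq_zero]
  intro x hx
  obtain ⟨t, α, rfl⟩ := inc_surj x
  obtain ⟨f, rfl⟩ := Abelian.Ext.mk₀_bijective _ _ |>.2 α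
  rw [ev_inc] at hx
  have : f = 0 := by
    ext
    exact hx
  rw [this, Abelian.Ext.mk₀_zero, map_zero]

lemma ev_surj (m : M) {t : ℕ} (hm : ∀ r ∈ a ^ t, r • m = 0) : ∃ x, ev a M x = m := by
  let f : Q a t ⟶ M := ModuleCat.ofHom (Submodule.liftQ (a ^ t) (LinearMap.toSpanSingleton R M m) 
    (fun r hr => by rw [LinearMap.mem_ker]; exact hm r hr))
  refine ⟨inc _ _ _ _ (Abelian.Ext.mk₀ f), ?_⟩
  rw [ev_inc]
  exact one_smul R m
end


section
variable {S : ShortComplex (ModuleCat.{u} R)} (hS : S.ShortExact) {a : Ideal R} {n : ℕ}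

lemma δ_comp (x : H a n S.X₂) : δ a n hS (Hm a n S.g x) = 0 := by
  obtain ⟨t, α, rfl⟩ := inc_surj x
  rw [inc_map, δ_inc, Abelian.Ext.comp_assoc_of_second_deg_zero, hS.comp_extClass]
  simp
end

section
variable (a : Ideal R) (n : ℕ)
variable {M N P : Type u} [AddCommGroup M] [Module R M] [AddCommGroup N] [Module R N]
  [AddCommGroup P] [Module R P]

abbrev LH (M : Type u) [AddCommGroup M] [Module R M] : Type u := H a n (ModuleCat.of R M)

def lm (f : M →ₗ[R] N) : LH a n M →ₗ[R] LH a n N := Hm a n (ModuleCat.ofHom f)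

variable {a n}

lemma lm_comp (g : N →ₗ[R] P) (f : M →ₗ[R] N) (x) : lm a n (g ∘ₗ f) x = lm a n g (lm a n f x) := 
  Hm_comp (ModuleCat.ofHom f) (ModuleCat.ofHom g) x

lemma lm_smul (r : R) (x) : lm a n (r • (LinearMap.id : M →ₗ[R] M)) x = r • x := 
  Hm_smul (M := ModuleCat.of R M) r x

lemma lm_id (x) : lm a n (LinearMap.id : M →ₗ[R] M) x = x := by
  have := lm_smul (a := a) (n := n) (M := M) 1 x
  rwa [one_smul, one_smul] at this

lemma lm_zero (x) : lm a n (0 : M →ₗ[R] N) x = 0 := by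
  have := lm_comp (a := a) (n := n) (0 : M →ₗ[R] N) ((0 : R) • LinearMap.id) x
  rw [lm_smul, zero_smul R x, map_zero] at this
  simpa using this

lemma lm_sum {ι : Type*} (s : Finset ι) (f : ι → M →ₗ[R] N) (x) : 
    lm a n (∑ i ∈ s, f i) x = ∑ i ∈ s, lm a n (f i) x := by
  classical
  induction s using Finset.induction_on with
  | empty => simp [lm_zero]
  | insert i s h ih => 
    rw [Finset.sum_insert h, Finset.sum_insert h, ← ih]
    exact Hm_add (ModuleCat.ofHom (f i)) (ModuleCat.ofHom (∑ i ∈ s, f i)) x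

lemma lm_iso (e : M ≃ₗ[R] N) : Function.Bijective (lm a n e.toLinearMap) := by
  have h1 : ∀ x, lm a n e.symm.toLinearMap (lm a n e.toLinearMap x) = x := fun x => by
    rw [← lm_comp, LinearEquiv.symm_comp, lm_id]
  have h2 : ∀ x, lm a n e.toLinearMap (lm a n e.symm.toLinearMap x) = x := fun x => by
    rw [← lm_comp, LinearEquiv.comp_symm, lm_id]
  exact ⟨Function.LeftInverse.injective h1, Function.RightInverse.surjective h2⟩

def lmEquiv (e : M ≃ₗ[R] N) : LH a n M ≃ₗ[R] LH a n N := LinearEquiv.ofBijective _ (lm_iso e)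

def sc (f : M →ₗ[R] N) (g : N →ₗ[R] P) (hfg : Function.Exact f g) : ShortComplex (ModuleCat.{u} R) :=
  ShortComplex.mk (ModuleCat.ofHom f) (ModuleCat.ofHom g) (by
    ext x; exact (hfg (f x)).2 ⟨x, rfl⟩)

lemma sc_exact (f : M →ₗ[R] N) (g : N →ₗ[R] P) (hf : Function.Injective f) (hg : Function.Surjective g) 
    (hfg : Function.Exact f g) : (sc f g hfg).ShortExact where
  exact := by
    rw [ShortComplex.ShortExact.moduleCat_exact_iff_function_exact]
    exact hfg
  mono_f := (ModuleCat.mono_iff_injective _).2 hf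
  epi_g := (ModuleCat.epi_iff_surjective _).2 hg

variable {f : M →ₗ[R] N} {g : N →ₗ[R] P} (hf : Function.Injective f) (hg : Function.Surjective g) 
    (hfg : Function.Exact f g)

lemma lex2 (hf : Function.Injective f) (hg : Function.Surjective g) (hfg : Function.Exact f g) 
    (x : LH a n N) (hx : lm a n g x = 0) : ∃ y, lm a n f y = x := 
  H_ex2 (sc_exact f g hf hg hfg) x hx

lemma lex1 (hf : Function.Injective f) (hg : Function.Surjective g) (hfg : Function.Exact f g) (a : Ideal R) (n : ℕ) : 
    ∃ d : LH a n P →ₗ[R] LH a (n+1) M, (∀ x, d x = 0 → ∃ y, lm a n g y = x) ∧ 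
      (∀ y, d (lm a n g y) = 0) ∧ (∀ x, lm a (n+1) f x = 0 → ∃ y, d y = x) := 
  ⟨δ a n (sc_exact f g hf hg hfg), H_ex3 (sc_exact f g hf hg hfg), δ_comp (sc_exact f g hf hg hfg), 
    H_ex1 (sc_exact f g hf hg hfg)⟩

lemma lex0 (hf : Function.Injective f) : Function.Injective (lm a 0 f) := by
  rw [injective_iff_map_eq_zero]
  exact H_ex0 (sc_exact f (LinearMap.range f).mkQ hf (Submodule.mkQ_surjective _) 
    (LinearMap.exact_map_mkQ_range f))

lemma LH_torsion (x : LH a n M) : ∃ t, ∀ r ∈ a ^ t, r • x = 0 := H_torsion x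

lemma LH_inj [Module.Injective R M] (x : LH a (n+1) M) : x = 0 := by
  have : Injective (ModuleCat.of R M) := (Module.injective_iff_injective_object R M).1 inferInstance
  exact H_inj x

lemma lev (a : Ideal R) (M : Type u) [AddCommGroup M] [Module R M] : ∃ e : LH a 0 M →ₗ[R] M, Function.Injective e ∧ 
    ∀ m t, (∀ r ∈ a ^ t, r • m = 0) → ∃ x, e x = m := 
  ⟨ev a _, ev_inj, fun _ _ h => ev_surj _ h⟩

/-- vanishing -/
abbrev Van (a : Ideal R) (n : ℕ) (M : Type u) [AddCommGroup M] [Module R M] : Prop := Subsingleton (LH a n M)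

lemma Van.mid (hf : Function.Injective f) (hg : Function.Surjective g) (hfg : Function.Exact f g) 
    (h1 : Van a n M) (h2 : Van a n P) : Van a n N := by
  refine subsingleton_of_forall_eq 0 fun x => ?_
  obtain ⟨y, rfl⟩ := lex2 hf hg hfg x (Subsingleton.elim _ _)
  rw [Subsingleton.elim y 0, map_zero]

lemma Van.iso (e : M ≃ₗ[R] N) (h : Van a n M) : Van a n N := 
  (lmEquiv e).symm.toEquiv.subsingleton 

lemma lm_surj_of_van (hf : Function.Injective f) (hg : Function.Surjective g) (hfg : Function.Exact f g) 
    (h : Van a (n+1) M) : Function.Surjective (lm a n g) := by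
  obtain ⟨d, h1, -⟩ := lex1 hf hg hfg a n
  exact fun x => h1 x (Subsingleton.elim _ _)

lemma lm_surj_of_van' (hf : Function.Injective f) (hg : Function.Surjective g) (hfg : Function.Exact f g) 
    (h : Van a n P) : Function.Surjective (lm a n f) := 
  fun x => lex2 hf hg hfg x (Subsingleton.elim _ _)

lemma lm_inj_of_van (hf : Function.Injective f) (hg : Function.Surjective g) (hfg : Function.Exact f g) 
    (h : Van a n P) : Function.Injective (lm a (n+1) f) := by
  obtain ⟨d, -, -, h1⟩ := lex1 hf hg hfg a n
  rw [injective_iff_map_eq_zero]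
  intro x hx
  obtain ⟨y, rfl⟩ := h1 x hx
  rw [Subsingleton.elim y 0, map_zero]

lemma van_of_inj (x : R) (hx : x ∈ a) (h : ∀ z : LH a n M, x • z = 0 → z = 0) : Van a n M := by
  refine subsingleton_of_forall_eq 0 fun z => ?_
  obtain ⟨t, ht⟩ := LH_torsion z
  have := ht _ (Ideal.pow_mem_pow hx t)
  clear ht
  induction t with
  | zero => simpa using this
  | succ t ih => exact ih (h _ (by rw [smul_smul, ← pow_succ']; exact this))
end



section
variable (a : Ideal R)

def Gam (E : Type u) [AddCommGroup E] [Module R E] : Submodule R E where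
  carrier := {m | ∃ t : ℕ, ∀ r ∈ a ^ t, r • m = 0}
  zero_mem' := ⟨0, by simp⟩
  add_mem' := by
    rintro x y ⟨t, ht⟩ ⟨s, hs⟩
    refine ⟨t + s, fun r hr => ?_⟩
    rw [smul_add, ht r (Ideal.pow_le_pow_right (Nat.le_add_right _ _) hr), 
      hs r (Ideal.pow_le_pow_right (Nat.le_add_left _ _) hr), add_zero]
  smul_mem' := by
    rintro c x ⟨t, ht⟩
    exact ⟨t, fun r hr => by rw [smul_comm, ht r hr, smul_zero]⟩

lemma Gam_fg {E : Type u} [AddCommGroup E] [Module R E] (N : Submodule R E) (hN : N.FG) (h : N ≤ Gam a E) : 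
    ∃ t : ℕ, ∀ r ∈ a ^ t, ∀ x ∈ N, r • x = 0 := by
  induction N, hN using Submodule.fg_induction with
  | singleton x =>
    obtain ⟨t, ht⟩ := h (Submodule.mem_span_singleton_self x)
    refine ⟨t, fun r hr y hy => ?_⟩
    obtain ⟨c, rfl⟩ := Submodule.mem_span_singleton.1 hy
    rw [smul_comm, ht r hr, smul_zero]
  | sup N₁ N₂ _ _ h1 h2 =>
    obtain ⟨t, ht⟩ := h1 (le_sup_left.trans h)
    obtain ⟨s, hs⟩ := h2 (le_sup_right.trans h)
    refine ⟨t + s, fun r hr y hy => ?_⟩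
    obtain ⟨y1, h1, y2, h2, rfl⟩ := Submodule.mem_sup.1 hy
    rw [smul_add, ht r (Ideal.pow_le_pow_right (Nat.le_add_right _ _) hr) _ h1, 
      hs r (Ideal.pow_le_pow_right (Nat.le_add_left _ _) hr) _ h2, add_zero]

variable [IsNoetherianRing R]

lemma artin_rees (I : Ideal R) : ∃ k, ∀ t, a ^ (t + k) ⊓ I ≤ a ^ t * I := by
  obtain ⟨k, hk⟩ := Ideal.exists_pow_inf_eq_pow_smul a I
  refine ⟨k, fun t => ?_⟩
  have := hk (t + k) (Nat.le_add_left _ _)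
  rw [Nat.add_sub_cancel, smul_eq_mul, Ideal.mul_top, smul_eq_mul] at this
  rw [this]
  exact Ideal.mul_mono_right inf_le_right

omit [IsNoetherianRing R] in
lemma kill_mul {E : Type u} [AddCommGroup E] [Module R E] (J I : Ideal R) (g : I →ₗ[R] E) 
    (h : ∀ r ∈ J, ∀ x, r • g x = 0) : ∀ y ∈ J * I, ∀ hy : y ∈ I, g ⟨y, hy⟩ = 0 := by
  intro y hy
  induction hy using Submodule.mul_induction_on' with
  | mem_mul_mem r hr z hz => 
    intro _
    have := map_smul g r ⟨z, hz⟩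
    exact this.trans (h r hr _)
  | add y hy z hz h1 h2 =>
    intro _
    have hle : J * I ≤ I := Ideal.mul_le_right
    have hy' : y ∈ I := hle hy
    have hz' : z ∈ I := hle hz
    have := map_add g ⟨y, hy'⟩ ⟨z, hz'⟩
    rw [h1, h2, add_zero] at this
    exact this

lemma Gam_injective (E : Type u) [AddCommGroup E] [Module R E] [Module.Injective R E] : 
    Module.Injective R (Gam a E) := by
  apply Module.Baer.injective
  intro I g
  let g' : I →ₗ[R] E := (Gam a E).subtype ∘ₗ g
  obtain ⟨t, ht⟩ := Gam_fg a (LinearMap.range g') (by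
    rw [LinearMap.range_eq_map]
    exact Submodule.FG.map _ (Module.Finite.fg_top)) (by
    rintro _ ⟨x, rfl⟩; exact (g x).2)
  obtain ⟨k, hk⟩ := artin_rees a I
  have key : ∀ x : I, (x : R) ∈ a ^ (t + k) → g' x = 0 := fun x hx => 
    kill_mul (a ^ t) I g' (fun r hr x => ht r hr _ ⟨x, rfl⟩) x (hk t ⟨hx, x.2⟩) x.2
  let f : I →ₗ[R] R ⧸ a ^ (t + k) := (a ^ (t + k)).mkQ ∘ₗ I.subtype
  have hker : LinearMap.ker f ≤ LinearMap.ker g' := by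
    intro x hx
    rw [LinearMap.mem_ker] at hx ⊢
    exact key x ((Submodule.Quotient.mk_eq_zero _).1 hx)
  obtain ⟨h, hh⟩ := Module.Injective.out (Submodule.liftQ _ f le_rfl : (I ⧸ LinearMap.ker f) →ₗ[R] _) 
    (by rw [← LinearMap.ker_eq_bot]; exact Submodule.ker_liftQ_eq_bot _ _ _ le_rfl) 
    (Submodule.liftQ _ g' hker)
  have hG : ∀ y, h y ∈ Gam a E := fun y => ⟨t + k, fun r hr => by
    rw [← map_smul]
    have : r • y = 0 := by
      obtain ⟨y, rfl⟩ := Submodule.mkQ_surjective _ y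
      rw [← map_smul]
      exact (Submodule.Quotient.mk_eq_zero _).2 (Ideal.mul_mem_right _ _ hr)
    rw [this, map_zero]⟩
  refine ⟨(h.codRestrict _ hG) ∘ₗ (a ^ (t + k)).mkQ, fun x mem => ?_⟩
  apply Subtype.ext
  exact hh (Submodule.Quotient.mk ⟨x, mem⟩)

lemma van_torsion (i : ℕ) : ∀ (M : Type u) [AddCommGroup M] [Module R M] 
    (_ : ∀ m : M, ∃ t : ℕ, ∀ r ∈ a ^ t, r • m = 0), Van a (i + 1) M := by
  induction i with
  | zero =>
    intro M _ _ hM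
    let E : ModuleCat.{u} R := Injective.under (ModuleCat.of R M)
    have : Injective (ModuleCat.of R E) := inferInstanceAs (Injective (Injective.under (ModuleCat.of R M)))
    have : Module.Injective R E := Module.injective_module_of_injective_object R E
    have := Gam_injective a E
    let ι : M →ₗ[R] E := (Injective.ι (ModuleCat.of R M)).hom
    have hι : Function.Injective ι := (ModuleCat.mono_iff_injective _).1 inferInstance
    let f : M →ₗ[R] Gam a E := ι.codRestrict _ fun m => by
      obtain ⟨t, ht⟩ := hM m
      exact ⟨t, fun r hr => by rw [← map_smul, ht r hr, map_zero]⟩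
    have hf : Function.Injective f := fun x y h => hι congr(($h : E))
    obtain ⟨d, h1, h2, h3⟩ := lex1 hf (Submodule.mkQ_surjective _) (LinearMap.exact_map_mkQ_range f) a 0
    refine subsingleton_of_forall_eq 0 fun x => ?_
    obtain ⟨y, rfl⟩ := h3 x (LH_inj _)
    obtain ⟨w, hw⟩ := Submodule.mkQ_surjective _ (ev a _ y)
    obtain ⟨t, ht⟩ := w.2
    obtain ⟨z, hz⟩ := ev_surj (M := ModuleCat.of R (Gam a E)) w (t := t) (a := a) fun r hr => Subtype.ext (ht r hr)
    have : y = lm a 0 (LinearMap.range f).mkQ z := ev_inj (hw.symm.trans (by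
      rw [← hz]; exact (ev_map (ModuleCat.ofHom (LinearMap.range f).mkQ) z).symm))
    rw [this, h2]
  | succ i ih =>
    intro M _ _ hM
    let E : ModuleCat.{u} R := Injective.under (ModuleCat.of R M)
    have : Injective (ModuleCat.of R E) := inferInstanceAs (Injective (Injective.under (ModuleCat.of R M)))
    have : Module.Injective R E := Module.injective_module_of_injective_object R E
    have := Gam_injective a E
    let ι : M →ₗ[R] E := (Injective.ι (ModuleCat.of R M)).hom
    have hι : Function.Injective ι := (ModuleCat.mono_iff_injective _).1 inferInstance
    let f : M →ₗ[R] Gam a E := ι.codRestrict _ fun m => by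
      obtain ⟨t, ht⟩ := hM m
      exact ⟨t, fun r hr => by rw [← map_smul, ht r hr, map_zero]⟩
    have hf : Function.Injective f := fun x y h => hι congr(($h : E))
    obtain ⟨d, h1, h2, h3⟩ := lex1 hf (Submodule.mkQ_surjective _) (LinearMap.exact_map_mkQ_range f) a (i+1)
    refine subsingleton_of_forall_eq 0 fun x => ?_
    obtain ⟨y, rfl⟩ := h3 x (LH_inj _)
    have hv := ih (Gam a E ⧸ LinearMap.range f) (fun m => by
      obtain ⟨w, rfl⟩ := Submodule.mkQ_surjective _ m
      obtain ⟨t, ht⟩ := w.2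
      exact ⟨t, fun r hr => by rw [← map_smul, show r • w = 0 from Subtype.ext (ht r hr), map_zero]⟩)
    rw [Subsingleton.elim y 0, map_zero]
end


section
variable {a : Ideal R} {n : ℕ}

lemma van_sub {M : Type u} [AddCommGroup M] [Module R M] [Subsingleton M] : Van a n M := by
  refine subsingleton_of_forall_eq 0 fun x => ?_
  rw [← lm_id x, show (LinearMap.id : M →ₗ[R] M) = 0 from Subsingleton.elim _ _, lm_zero]

lemma filt [IsNoetherianRing R] (I : Ideal R) (C : ∀ (N : Type u) [AddCommGroup N] [Module R N], Prop)
    (hsub : ∀ (N : Type u) [AddCommGroup N] [Module R N], Subsingleton N → C N)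
    (hiso : ∀ (N N' : Type u) [AddCommGroup N] [Module R N] [AddCommGroup N'] [Module R N'], 
      (N ≃ₗ[R] N') → C N → C N')
    (hex : ∀ (N₁ N₂ N₃ : Type u) [AddCommGroup N₁] [Module R N₁] [AddCommGroup N₂] [Module R N₂]
      [AddCommGroup N₃] [Module R N₃] (f : N₁ →ₗ[R] N₂) (g : N₂ →ₗ[R] N₃), 
      Function.Injective f → Function.Surjective g → Function.Exact f g → C N₁ → C N₃ → C N₂)
    (h : ∀ P : Ideal R, P.IsPrime → I ≤ P → C (R ⧸ P)) 
    (M : Type u) [AddCommGroup M] [Module R M] [hM : Module.Finite R M] (hI : I ≤ Module.annihilator R M) : C M := by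
  induction hM using IsNoetherianRing.induction_on_isQuotientEquivQuotientPrime R with
  | subsingleton N => exact hsub N inferInstance
  | quotient N p e =>
    refine hiso _ _ e.symm (h _ p.2 ?_)
    rwa [e.annihilator_eq, Ideal.annihilator_quotient] at hI
  | exact N₁ N₂ N₃ f g hf hg hfg h1 h3 =>
    exact hex _ _ _ f g hf hg hfg (h1 (hI.trans (LinearMap.annihilator_le_of_injective f hf))) 
      (h3 (hI.trans (LinearMap.annihilator_le_of_surjective g hg)))

lemma van_filt [IsNoetherianRing R] (I : Ideal R) 
    (h : ∀ P : Ideal R, P.IsPrime → I ≤ P → Van a n (R ⧸ P)) 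
    (M : Type u) [AddCommGroup M] [Module R M] [hM : Module.Finite R M] (hI : I ≤ Module.annihilator R M) : 
    Van a n M := 
  filt I (fun N => Van a n N) (fun N _ _ _ => van_sub) (fun _ _ _ _ _ _ e h => Van.iso e h) 
    (fun _ _ _ _ _ _ _ _ _ _ _ hf hg hfg h1 h2 => Van.mid hf hg hfg h1 h2) h M hI

lemma mulseq (P : Ideal R) [P.IsPrime] (x : R) (hx : x ∉ P) : 
    ∃ (g : (R ⧸ P) →ₗ[R] (R ⧸ (P ⊔ Ideal.span {x}))), Function.Injective (x • (LinearMap.id : (R ⧸ P) →ₗ[R] (R ⧸ P))) ∧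
      Function.Surjective g ∧ Function.Exact (x • (LinearMap.id : (R ⧸ P) →ₗ[R] (R ⧸ P))) g := by
  refine ⟨Submodule.factor le_sup_left, ?_, Submodule.factor_surjective _, ?_⟩
  · rw [injective_iff_map_eq_zero]
    intro y hy
    obtain ⟨y, rfl⟩ := Ideal.Quotient.mk_surjective y
    have : Ideal.Quotient.mk P (x * y) = 0 := hy
    rw [Ideal.Quotient.eq_zero_iff_mem] at this ⊢
    exact (‹P.IsPrime›.mem_or_mem this).resolve_left hx
  · intro y
    obtain ⟨y, rfl⟩ := Ideal.Quotient.mk_surjective y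
    change Ideal.Quotient.mk (P ⊔ Ideal.span {x}) y = 0 ↔ _
    rw [Ideal.Quotient.eq_zero_iff_mem, Submodule.mem_sup]
    constructor
    · rintro ⟨p, hp, z, hz, rfl⟩
      obtain ⟨c, rfl⟩ := Ideal.mem_span_singleton'.1 hz
      refine ⟨Ideal.Quotient.mk P c, ?_⟩
      change Ideal.Quotient.mk P (x * c) = _
      rw [Ideal.Quotient.eq]
      have := neg_mem hp
      convert this using 1
      ring
    · rintro ⟨c, hc⟩
      obtain ⟨c, rfl⟩ := Ideal.Quotient.mk_surjective c
      have : Ideal.Quotient.mk P (x * c) = Ideal.Quotient.mk P y := hc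
      rw [eq_comm, Ideal.Quotient.eq] at this
      exact ⟨_, this, x * c, Ideal.mem_span_singleton.2 (dvd_mul_right _ _), by ring⟩

lemma van_step (P : Ideal R) [P.IsPrime] (x : R) (hx : x ∉ P) (hxa : x ∈ a) 
    (h : Van a n (R ⧸ (P ⊔ Ideal.span {x}))) : Van a (n+1) (R ⧸ P) := by
  obtain ⟨g, h1, h2, h3⟩ := mulseq P x hx
  refine van_of_inj x hxa fun z hz => ?_
  exact lm_inj_of_van h1 h2 h3 h (by rw [lm_smul, hz, map_zero])

variable [IsNoetherianRing R]

lemma van_le (I : Ideal R) (h : a ≤ I) (M : Type u) [AddCommGroup M] [Module R M] 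
    (hI : I ≤ Module.annihilator R M) : Van a (n+1) M := 
  van_torsion a n M fun m => ⟨1, fun r hr => Module.mem_annihilator.1 (hI (h (by simpa using hr))) m⟩

lemma van_gens : ∀ (l : List R) (_ : ∀ x ∈ l, x ∈ a) (I : Ideal R) (_ : a ≤ (Ideal.ofList l ⊔ I).radical) (i : ℕ) 
    (_ : l.length < i) (M : Type u) [AddCommGroup M] [Module R M] [Module.Finite R M] 
    (_ : I ≤ Module.annihilator R M), Van a i M
  | [], _, I, h, i, hi, M, _, _, _, hI => by
    obtain ⟨i, rfl⟩ : ∃ j, i = j + 1 := ⟨i - 1, by simp at hi; omega⟩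
    refine van_filt I (fun P hP hIP => van_le P ?_ _ ?_) M hI
    · refine h.trans ((Ideal.radical_mono (J := P) (sup_le (by simp) hIP)).trans ?_)
      rw [hP.radical]
    · rw [Ideal.annihilator_quotient]
  | x :: l, hl, I, h, i, hi, M, _, _, _, hI => by
    obtain ⟨i, rfl⟩ : ∃ j, i = j + 1 := ⟨i - 1, by simp at hi; omega⟩
    have hi : l.length < i := by simpa using hi
    refine van_filt I (fun P hP hIP => ?_) M hI
    have hP' : a ≤ (Ideal.ofList l ⊔ (P ⊔ Ideal.span {x})).radical := 
      h.trans (Ideal.radical_mono (by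
        rw [Ideal.ofList_cons]
        refine sup_le (sup_le ?_ le_sup_left) (hIP.trans (le_sup_left.trans le_sup_right))
        exact le_sup_right.trans le_sup_right))
    by_cases hx : x ∈ P
    · refine van_gens l (fun y hy => hl y (by simp [hy])) P ?_ (i+1) (by omega) _ (by rw [Ideal.annihilator_quotient])
      rwa [sup_eq_left.2 (show Ideal.span {x} ≤ P by simpa [Ideal.span_le] using hx)] at hP'
    · refine van_step P x hx (hl x (by simp)) ?_
      exact van_gens l (fun y hy => hl y (by simp [hy])) _ hP' i hi _ (by rw [Ideal.annihilator_quotient])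

omit [IsNoetherianRing R] in
lemma dim_mono {I J : Ideal R} (h : I ≤ J) : ringKrullDim (R ⧸ J) ≤ ringKrullDim (R ⧸ I) :=
  ringKrullDim_le_of_surjective (Ideal.Quotient.factor h) (Ideal.Quotient.factor_surjective h)

omit [IsNoetherianRing R] in
lemma dim_succ_le {P I : Ideal R} [P.IsPrime] (h : P ≤ I) {x : R} (hx : x ∉ P) (hxI : x ∈ I) : 
    ringKrullDim (R ⧸ I) + 1 ≤ ringKrullDim (R ⧸ P) := by
  have h1 := ringKrullDim_succ_le_of_surjective (Ideal.Quotient.factor h) (Ideal.Quotient.factor_surjective h)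
    (r := Ideal.Quotient.mk P x) (mem_nonZeroDivisors_of_ne_zero (by rwa [Ne, Ideal.Quotient.eq_zero_iff_mem])) (by
      simpa [Ideal.Quotient.eq_zero_iff_mem] using hxI)
  exact h1

omit [IsNoetherianRing R] in
lemma dim_lt {P I : Ideal R} [P.IsPrime] (h : P ≤ I) {x : R} (hx : x ∉ P) (hxI : x ∈ I) {k : ℕ} 
    (hk : ringKrullDim (R ⧸ P) < ((k + 1 : ℕ) : WithBot ℕ∞)) : ringKrullDim (R ⧸ I) < (k : WithBot ℕ∞) := by
  have h1 := (dim_succ_le h hx hxI).trans_lt hk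
  generalize ringKrullDim (R ⧸ I) = d at h1
  by_contra! hd
  have := add_le_add_left hd 1
  push_cast at h1
  exact absurd (this.trans_lt h1) (lt_irrefl _)

lemma groth : ∀ (k : ℕ) (I : Ideal R) (_ : ringKrullDim (R ⧸ I) < (k : WithBot ℕ∞)) 
    (M : Type u) [AddCommGroup M] [Module R M] [Module.Finite R M] 
    (_ : I ≤ Module.annihilator R M), Van a k M
  | 0, I, h, M, _, _, _, hI => by
    have : I = ⊤ := by
      by_contra hne
      have : Nontrivial (R ⧸ I) := Ideal.Quotient.nontrivial_iff.2 hne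
      have := ringKrullDim_nonneg_of_nontrivial (R := R ⧸ I)
      exact absurd (this.trans_lt h) (lt_irrefl _)
    have : Subsingleton M := by
      rw [this, top_le_iff, Module.annihilator_eq_top_iff] at hI
      exact hI
    exact van_sub
  | k + 1, I, h, M, _, _, _, hI => by
    refine van_filt I (fun P hP hIP => ?_) M hI
    by_cases haP : a ≤ P
    · exact van_le P haP _ (by rw [Ideal.annihilator_quotient])
    · obtain ⟨x, hxa, hxP⟩ := SetLike.not_le_iff_exists.1 haP
      refine van_step P x hxP hxa ?_
      refine groth k (P ⊔ Ideal.span {x}) (dim_lt le_sup_left hxP (Ideal.mem_sup_right (Ideal.mem_span_singleton_self x)) 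
        ((dim_mono hIP).trans_lt h)) _ (by rw [Ideal.annihilator_quotient])
end


section
variable {E : Type u} [AddCommGroup E] [Module R E]

def Aij (x : R) (L : Submodule R E) (i : ℕ) : Submodule R E :=
  (L ⊓ LinearMap.ker (x ^ (i + 1) • (LinearMap.id : E →ₗ[R] E))).map (x ^ i • (LinearMap.id : E →ₗ[R] E))

lemma mem_Aij (x : R) (L : Submodule R E) (i : ℕ) (w : E) : w ∈ Aij x L i ↔ ∃ y ∈ L, x ^ (i+1) • y = 0 ∧ x ^ i • y = w := by
  simp [Aij, and_assoc]

lemma Aij_anti (x : R) {L L' : Submodule R E} (h : L ≤ L') {i i' : ℕ} (hi : i' ≤ i) : Aij x L i ≤ Aij x L' i' := by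
  intro w hw
  rw [mem_Aij] at hw ⊢
  obtain ⟨y, hy, h1, rfl⟩ := hw
  obtain ⟨k, rfl⟩ := Nat.exists_eq_add_of_le hi
  refine ⟨x ^ k • y, L'.smul_mem _ (h hy), ?_, ?_⟩
  · rw [smul_smul, ← pow_add, ← h1]; congr 2; ring
  · rw [smul_smul, ← pow_add]

lemma stab_of_artinian (K : Submodule R E) [IsArtinian R K] (A : ℕ → Submodule R E) (hA : Antitone A) (hK : ∀ i, A i ≤ K) : 
    ∃ n, ∀ m, n ≤ m → A n = A m := by
  obtain ⟨n, hn⟩ := monotone_stabilizes_iff_artinian.2 ‹IsArtinian R K› 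
    ⟨fun i => OrderDual.toDual ((A i).comap K.subtype), fun i j h => Submodule.comap_mono (hA h)⟩
  refine ⟨n, fun m hm => ?_⟩
  have h2 : (A n).comap K.subtype = (A m).comap K.subtype := hn m hm
  have h3 := congrArg (Submodule.map K.subtype) h2
  simpa [Submodule.map_comap_subtype, inf_eq_right.2 (hK _)] using h3

lemma melkersson (x : R) (h : ∀ y : E, ∃ t : ℕ, x ^ t • y = 0) 
    [IsArtinian R (LinearMap.ker (x • (LinearMap.id : E →ₗ[R] E)))] : IsArtinian R E := by
  rw [← monotone_stabilizes_iff_artinian]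
  intro f
  let L : ℕ → Submodule R E := fun i => OrderDual.ofDual (f i)
  have hL : Antitone L := fun i j h => f.monotone h
  have hK : ∀ i j, Aij x (L j) i ≤ LinearMap.ker (x • (LinearMap.id : E →ₗ[R] E)) := by
    intro i j w hw
    rw [mem_Aij] at hw
    obtain ⟨y, hy, h1, rfl⟩ := hw
    rw [LinearMap.mem_ker, LinearMap.smul_apply, LinearMap.id_apply, smul_smul, ← pow_succ']
    exact h1
  obtain ⟨N, hN⟩ := stab_of_artinian _ (fun i => Aij x (L i) i) (fun i j h => Aij_anti x (hL h) h) (fun i => hK i i)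
  have hrow : ∀ i, ∃ n, ∀ m, n ≤ m → Aij x (L n) i = Aij x (L m) i := fun i =>
    stab_of_artinian _ (fun j => Aij x (L j) i) (fun j j' h => Aij_anti x (hL h) le_rfl) (fun j => hK i j)
  choose g hg using hrow
  let B := max N ((Finset.range N).sup g)
  have key : ∀ i j, B ≤ j → Aij x (L B) i = Aij x (L j) i := by
    intro i j hj
    by_cases hi : i < N
    · have h1 : g i ≤ B := le_max_of_le_right (Finset.le_sup (f := g) (by simpa using hi))
      rw [← hg i B h1, ← hg i j (h1.trans hj)]
    · push Not at hi
      have hc : ∀ j, N ≤ j → Aij x (L j) i = Aij x (L N) N := fun j hj => by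
        apply le_antisymm (Aij_anti x (hL hj) hi)
        have := hN (max i j) (hj.trans (le_max_right _ _))
        rw [this]
        exact Aij_anti x (hL (le_max_right _ _)) (le_max_left _ _)
      have hNB : N ≤ B := le_max_left _ _
      rw [hc B hNB, hc j (hNB.trans hj)]
  refine ⟨B, fun j hj => ?_⟩
  change L B = L j
  apply le_antisymm _ (hL hj)
  have : ∀ i, ∀ y ∈ L B, x ^ i • y = 0 → y ∈ L j := by
    intro i
    induction i with
    | zero => 
      intro y _ hy0
      rw [pow_zero, one_smul] at hy0
      rw [hy0]; exact zero_mem _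
    | succ i ih =>
      intro y hy hy0
      have h1 : x ^ i • y ∈ Aij x (L B) i := (mem_Aij _ _ _ _).2 ⟨y, hy, hy0, rfl⟩
      rw [key i j hj, mem_Aij] at h1
      obtain ⟨z, hz, hz0, e⟩ := h1
      have := ih (y - z) (sub_mem hy (hL hj hz)) (by rw [smul_sub, e, sub_self])
      simpa using add_mem this hz
  intro y hy
  obtain ⟨t, ht⟩ := h y
  exact this t y hy ht
end

section
variable {a : Ideal R} [IsNoetherianRing R] [IsLocalRing R]
open IsLocalRing

lemma art : ∀ (i : ℕ) (I : Ideal R) (_ : maximalIdeal R ≤ (a ⊔ I).radical) 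
    (M : Type u) [AddCommGroup M] [Module R M] [Module.Finite R M] (_ : I ≤ Module.annihilator R M), 
    IsArtinian R (LH a i M) := by
  intro i
  induction i with
  | zero =>
    intro I hm M _ _ _ hI
    refine filt I (fun N => IsArtinian R (LH a 0 N)) ?_ ?_ ?_ ?_ M hI
    · intro N _ _ _
      have : Van a 0 N := van_sub
      exact inferInstance
    · intro N N' _ _ _ _ e h
      exact isArtinian_of_linearEquiv (lmEquiv e)
    · intro N1 N2 N3 _ _ _ _ _ _ f g hf hg hfg h1 h3
      refine isArtinian_of_range_eq_ker (lm a 0 f) (lm a 0 g) ?_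
      apply le_antisymm
      · rintro _ ⟨x, rfl⟩
        rw [LinearMap.mem_ker, ← lm_comp, hfg.linearMap_comp_eq_zero, lm_zero]
      · intro x hx
        exact lex2 hf hg hfg x hx
    · intro P hP hIP
      by_cases haP : a ≤ P
      · have : P = maximalIdeal R := by
          apply le_antisymm (le_maximalIdeal hP.ne_top)
          refine hm.trans ((Ideal.radical_mono (sup_le haP hIP)).trans ?_)
          rw [hP.radical]
        subst this
        obtain ⟨e, he, -⟩ := lev a (R ⧸ maximalIdeal R)
        have : IsSimpleModule R (R ⧸ maximalIdeal R) := by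
          rw [isSimpleModule_iff_isCoatom]; exact (maximalIdeal.isMaximal R).out
        exact isArtinian_of_injective e he
      · obtain ⟨x, hxa, hxP⟩ := SetLike.not_le_iff_exists.1 haP
        obtain ⟨g, h1, h2, h3⟩ := mulseq P x hxP
        have : Van a 0 (R ⧸ P) := van_of_inj x hxa fun z hz => 
          lex0 h1 (by rw [lm_smul, hz, map_zero])
        exact inferInstance
  | succ i ih =>
    intro I hm M _ _ _ hI
    refine filt I (fun N => IsArtinian R (LH a (i+1) N)) ?_ ?_ ?_ ?_ M hI
    · intro N _ _ _
      have : Van a (i+1) N := van_sub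
      exact inferInstance
    · intro N N' _ _ _ _ e h
      exact isArtinian_of_linearEquiv (lmEquiv e)
    · intro N1 N2 N3 _ _ _ _ _ _ f g hf hg hfg h1 h3
      refine isArtinian_of_range_eq_ker (lm a (i+1) f) (lm a (i+1) g) ?_
      apply le_antisymm
      · rintro _ ⟨x, rfl⟩
        rw [LinearMap.mem_ker, ← lm_comp, hfg.linearMap_comp_eq_zero, lm_zero]
      · intro x hx
        exact lex2 hf hg hfg x hx
    · intro P hP hIP
      by_cases haP : a ≤ P
      · have : Van a (i+1) (R ⧸ P) := van_le P haP _ (by rw [Ideal.annihilator_quotient])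
        exact inferInstance
      · obtain ⟨x, hxa, hxP⟩ := SetLike.not_le_iff_exists.1 haP
        obtain ⟨g, h1, h2, h3⟩ := mulseq P x hxP
        obtain ⟨d, -, -, hd⟩ := lex1 h1 h2 h3 a i
        have := ih (P ⊔ Ideal.span {x}) (hm.trans (Ideal.radical_mono (sup_le_sup_left (hIP.trans le_sup_left) _))) 
          (R ⧸ (P ⊔ Ideal.span {x})) (by rw [Ideal.annihilator_quotient])
        have hle : LinearMap.ker (x • (LinearMap.id : LH a (i+1) (R ⧸ P) →ₗ[R] LH a (i+1) (R ⧸ P))) ≤ LinearMap.range d := by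
          intro z hz
          obtain ⟨y, hy⟩ := hd z (by rw [lm_smul]; exact hz)
          exact ⟨y, hy⟩
        have : IsArtinian R (LinearMap.range d) := inferInstance
        have := isArtinian_of_le hle
        refine melkersson x (fun y => ?_)
        obtain ⟨t, ht⟩ := LH_torsion y
        exact ⟨t, ht _ (Ideal.pow_mem_pow hxa t)⟩
end


section
variable {a : Ideal R} {n : ℕ} 

lemma LH_kill {M : Type u} [AddCommGroup M] [Module R M] {r : R} (hr : r ∈ Module.annihilator R M) (z : LH a n M) : 
    r • z = 0 := by
  rw [← lm_smul, show r • (LinearMap.id : M →ₗ[R] M) = 0 from LinearMap.ext fun m => Module.mem_annihilator.1 hr m, lm_zero]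

lemma exists_prime_dim (I : Ideal R) (h : (n : WithBot ℕ∞) ≤ ringKrullDim (R ⧸ I)) : 
    ∃ P : Ideal R, P.IsPrime ∧ I ≤ P ∧ (n : WithBot ℕ∞) ≤ ringKrullDim (R ⧸ P) := by
  rw [ringKrullDim_quotient, Order.le_krullDim_iff] at h
  obtain ⟨l, hl⟩ := h
  refine ⟨l.head.1.asIdeal, l.head.1.2, l.head.2, ?_⟩
  rw [ringKrullDim_quotient, Order.le_krullDim_iff]
  refine ⟨⟨l.length, fun i => ⟨(l i).1, ?_⟩, fun i => ?_⟩, hl⟩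
  · exact l.head_le i
  · exact l.step i

variable [IsNoetherianRing R]

lemma ann_eq (P : Ideal R) [P.IsPrime] (hd : ringKrullDim (R ⧸ P) ≤ (n : WithBot ℕ∞)) (hv : ¬ Van a n (R ⧸ P)) 
   (x : R) (hx : ∀ z : LH a n (R ⧸ P), x • z = 0) : x ∈ P := by
  by_contra hxP
  obtain ⟨g, h1, h2, h3⟩ := mulseq P x hxP
  have hv' : Van a n (R ⧸ (P ⊔ Ideal.span {x})) := groth n (P ⊔ Ideal.span {x}) 
    (dim_lt (P := P) (x := x) le_sup_left hxP (Ideal.mem_sup_right (Ideal.mem_span_singleton_self x)) 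
      (hd.trans_lt (by exact_mod_cast Nat.lt_succ_self n))) _ (by rw [Ideal.annihilator_quotient])
  refine hv (subsingleton_of_forall_eq 0 fun z => ?_)
  obtain ⟨y, rfl⟩ := lm_surj_of_van' h1 h2 h3 hv' z
  rw [lm_smul, hx]

variable [IsLocalRing R]
open IsLocalRing

lemma dim_le_succ (I : Ideal R) {x : R} (hx : x ∈ maximalIdeal R) : 
    ringKrullDim (R ⧸ I) ≤ ringKrullDim (R ⧸ (I ⊔ Ideal.span {x})) + 1 := by
  have h1 := Module.supportDim_le_supportDim_quotSMulTop_succ (M := R ⧸ I) hx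
  rw [Module.supportDim_quotient_eq_ringKrullDim, Module.supportDim_eq_ringKrullDim_quotient_annihilator] at h1
  refine h1.trans (add_le_add_left (dim_mono (sup_le ?_ ?_)) 1)
  · exact le_trans (le_of_eq Ideal.annihilator_quotient.symm) 
      (LinearMap.annihilator_le_of_surjective (Submodule.mkQ _) (Submodule.mkQ_surjective _))
  · rw [Ideal.span_singleton_le_iff_mem, Module.mem_annihilator]
    intro m
    obtain ⟨m, rfl⟩ := Submodule.mkQ_surjective _ m
    rw [← map_smul]
    exact (Submodule.Quotient.mk_eq_zero _).2 (Submodule.smul_mem_pointwise_smul _ _ _ trivial)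

omit [IsNoetherianRing R] in
lemma dim_max : ringKrullDim (R ⧸ maximalIdeal R) = 0 := ringKrullDim_eq_zero_of_field (ResidueField R)

lemma eq_max_of_dim (P : Ideal R) [hP : P.IsPrime] (h : ringKrullDim (R ⧸ P) = ((0 : ℕ) : WithBot ℕ∞)) : P = maximalIdeal R := by
  by_contra hne
  have hlt := (le_maximalIdeal hP.ne_top).lt_of_ne hne
  obtain ⟨x, hx, hxP⟩ := SetLike.exists_of_lt hlt
  have := dim_lt (P := P) hlt.le hxP hx (k := 0) (by rw [h]; exact_mod_cast Nat.zero_lt_one)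
  rw [dim_max] at this
  exact lt_irrefl _ this

lemma avoid (p : Ideal R) [p.IsPrime] (hd : ringKrullDim (R ⧸ p) = ((n + 2 : ℕ) : WithBot ℕ∞)) {f : R} (hf : f ∉ p) 
    (hfm : f ∈ maximalIdeal R) : ∃ P : Ideal R, P.IsPrime ∧ p ≤ P ∧ f ∉ P ∧ ringKrullDim (R ⧸ P) = ((n + 1 : ℕ) : WithBot ℕ∞) := by
  let J := p ⊔ Ideal.span {f}
  have hmin : maximalIdeal R ∉ J.minimalPrimes := by
    intro h
    have h1 : ringKrullDim (R ⧸ J) ≤ 0 := by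
      by_contra! hlt
      obtain ⟨P, hP, hJP, hdP⟩ := exists_prime_dim (n := 1) J (Order.succ_le_of_lt hlt)
      have : P = maximalIdeal R := le_antisymm (le_maximalIdeal hP.ne_top) (h.2 ⟨hP, hJP⟩ (le_maximalIdeal hP.ne_top))
      rw [this, dim_max] at hdP
      exact absurd hdP (by simp)
    have h2 := (dim_le_succ p hfm).trans (add_le_add_left h1 1)
    rw [hd] at h2
    have : n + 2 ≤ 0 + 1 := by exact_mod_cast h2
    omega
  obtain ⟨x, hx, hxP⟩ : ∃ x ∈ maximalIdeal R, ∀ Q ∈ J.minimalPrimes, x ∉ Q := by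
    by_contra! hcon
    have := (Ideal.subset_union_prime_finite (J.finite_minimalPrimes_of_isNoetherianRing) (f := id) (I := maximalIdeal R) 0 0 
      (fun Q hQ _ _ => hQ.1.1)).1 (fun x hx => by
        obtain ⟨Q, hQ, hxQ⟩ := hcon x hx
        exact Set.mem_biUnion hQ hxQ)
    obtain ⟨Q, hQ, hle⟩ := this
    have : Q = maximalIdeal R := le_antisymm (le_maximalIdeal hQ.1.1.ne_top) hle
    exact hmin (this ▸ hQ)
  have h1 := dim_le_succ p hx
  rw [hd] at h1
  have h1' : ((n + 1 : ℕ) : WithBot ℕ∞) ≤ ringKrullDim (R ⧸ (p ⊔ Ideal.span {x})) := by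
    by_contra! hlt
    have h5 : ringKrullDim (R ⧸ (p ⊔ Ideal.span {x})) ≤ (n : WithBot ℕ∞) := 
      ENat.WithBot.lt_add_one_iff.1 (by exact_mod_cast hlt)
    have := h1.trans (add_le_add_left h5 1)
    have : n + 2 ≤ n + 1 := by exact_mod_cast this
    omega
  obtain ⟨P, hP, hle, hdP⟩ := exists_prime_dim _ h1'
  have hxinP : x ∈ P := hle (Ideal.mem_sup_right (Ideal.mem_span_singleton_self x))
  have hxp : x ∉ p := fun hxp => by
    obtain ⟨Q, hQ, -⟩ := Ideal.exists_minimalPrimes_le (I := J) (J := maximalIdeal R) 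
      (sup_le (le_maximalIdeal (Ideal.IsPrime.ne_top ‹_›)) (by simpa [Ideal.span_le] using hfm))
    exact hxP Q hQ (hQ.1.2 (Ideal.mem_sup_left hxp))
  have hpP : p ≤ P := le_sup_left.trans hle
  refine ⟨P, hP, hpP, fun hfP => ?_, ?_⟩
  · obtain ⟨Q, hQ, hQP⟩ := Ideal.exists_minimalPrimes_le (I := J) (J := P) 
      (sup_le hpP (by simpa [Ideal.span_le] using hfP))
    have := hQ.1.1
    have h3 : ringKrullDim (R ⧸ Q) < ((n + 2 : ℕ) : WithBot ℕ∞) := 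
      dim_lt (P := p) (I := Q) (le_sup_left.trans hQ.1.2) hf (hQ.1.2 (Ideal.mem_sup_right (Ideal.mem_span_singleton_self f))) 
       (by rw [hd]; exact_mod_cast Nat.lt_succ_self _)
    have h4 : ringKrullDim (R ⧸ P) < ((n + 1 : ℕ) : WithBot ℕ∞) := dim_lt hQP (hxP Q hQ) hxinP h3
    exact absurd (hdP.trans_lt h4) (lt_irrefl _)
  · refine le_antisymm ?_ hdP
    have h3 := dim_lt (P := p) (I := P) (k := n + 2) hpP hxp hxinP (by rw [hd]; exact_mod_cast Nat.lt_succ_self _)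
    exact ENat.WithBot.lt_add_one_iff.1 (by exact_mod_cast h3)

end


section
variable {a : Ideal R} {n : ℕ} [IsNoetherianRing R] 

lemma lm_surj_gen {M N : Type u} [AddCommGroup M] [Module R M] [AddCommGroup N] [Module R N] (f : M →ₗ[R] N) 
    (h1 : Van a (n+1) (LinearMap.ker f)) (h2 : Van a n (N ⧸ LinearMap.range f)) : Function.Surjective (lm a n f) := by
  have e : f = (LinearMap.range f).subtype ∘ₗ f.rangeRestrict := rfl
  intro z
  obtain ⟨y, rfl⟩ := lm_surj_of_van' (a := a) (n := n) (f := (LinearMap.range f).subtype) (g := (LinearMap.range f).mkQ) 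
    (Subtype.val_injective) (Submodule.mkQ_surjective _) (LinearMap.exact_subtype_mkQ _) h2 z
  obtain ⟨x, rfl⟩ := lm_surj_of_van (a := a) (n := n) (f := (LinearMap.ker f).subtype) (g := f.rangeRestrict) 
    (Subtype.val_injective) (LinearMap.surjective_rangeRestrict f) (by 
      intro y
      constructor
      · intro h
        exact ⟨⟨y, congr(($h : N))⟩, rfl⟩
      · rintro ⟨y, rfl⟩
        exact Subtype.ext y.2) h1 y
  exact ⟨x, by rw [← lm_comp]; rfl⟩

variable [IsLocalRing R]
open IsLocalRing

lemma nonvan0 (ha : a ≤ maximalIdeal R) : ¬ Van a 0 (R ⧸ maximalIdeal R) := by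
  intro hv
  obtain ⟨e, -, he⟩ := lev a (R ⧸ maximalIdeal R)
  obtain ⟨x, hx⟩ := he 1 1 (fun r hr => by
    change Ideal.Quotient.mk _ (r * 1) = 0
    rw [Ideal.Quotient.eq_zero_iff_mem, mul_one]
    exact ha (by simpa using hr))
  rw [Subsingleton.elim x 0, map_zero] at hx
  exact zero_ne_one hx

lemma nonvan (ha : a ≤ maximalIdeal R) (n : ℕ) : ∀ (p : Ideal R) (_ : p.IsPrime) (_ : maximalIdeal R ≤ (a ⊔ p).radical) 
    (_ : ringKrullDim (R ⧸ p) = (n : WithBot ℕ∞)), ¬ Van a n (R ⧸ p) := by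
  induction n with
  | zero =>
    intro p hp _ hd
    rw [eq_max_of_dim p hd]
    exact nonvan0 ha
  | succ n ih =>
    intro p hp hm hd hv
    have hvan : ∀ (M : Type u) [AddCommGroup M] [Module R M] [Module.Finite R M] (_ : p ≤ Module.annihilator R M), 
        Van a (n+1) M := by
      intro M _ _ _ hM
      refine van_filt p (fun P hP hpP => ?_) M hM
      by_cases hPp : P ≤ p
      · rw [le_antisymm hPp hpP]; exact hv
      · obtain ⟨x, hx, hxp⟩ := SetLike.not_le_iff_exists.1 hPp
        exact groth (n+1) P (dim_lt hpP hxp hx (by rw [hd]; exact_mod_cast Nat.lt_succ_self _)) _ 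
          (by rw [Ideal.annihilator_quotient])
    have hsurj : ∀ P : Ideal R, (h : p ≤ P) → 
       Function.Surjective (lm a n (Submodule.factor h : (R ⧸ p) →ₗ[R] (R ⧸ P))) := by
      intro P h
      refine lm_surj_gen _ (hvan _ ?_) ?_
      · exact (le_of_eq Ideal.annihilator_quotient.symm).trans 
          (LinearMap.annihilator_le_of_injective (Submodule.subtype _) Subtype.val_injective)
      · rw [LinearMap.range_eq_top.2 (Submodule.factor_surjective h)]
        exact van_sub
    obtain ⟨s, hs, hsp⟩ : ∃ s ∈ a, s ∉ p := by
      by_contra! hle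
      have h1 : maximalIdeal R ≤ p := hm.trans ((Ideal.radical_mono (sup_le hle le_rfl)).trans (by rw [hp.radical]))
      have h2 := le_antisymm (le_maximalIdeal hp.ne_top) h1
      rw [h2, dim_max] at hd
      have : 0 = n + 1 := by exact_mod_cast hd
      omega
    cases n with
    | zero =>
      obtain ⟨g, h1, h2, h3⟩ := mulseq p s hsp
      have hv0 : Van a 0 (R ⧸ p) := van_of_inj s hs fun z hz => lex0 h1 (by rw [lm_smul, hz, map_zero])
      refine nonvan0 ha (Function.Surjective.subsingleton (hsurj (maximalIdeal R) (le_maximalIdeal hp.ne_top)))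
    | succ n =>
      have := art (a := a) (n + 1) p hm (R ⧸ p) (by rw [Ideal.annihilator_quotient])
      let F : Ideal R → Submodule R (LH a (n+1) (R ⧸ p)) := fun J => J • ⊤
      obtain ⟨_, ⟨J, hJ, rfl⟩, hmin⟩ := (wellFounded_lt (α := Submodule R (LH a (n+1) (R ⧸ p)))).has_min 
        (F '' {J | ¬ J ≤ p}) ⟨_, ⊤, fun h => hp.ne_top (top_le_iff.1 h), rfl⟩
      obtain ⟨f, hfJ, hfp⟩ := SetLike.not_le_iff_exists.1 hJ
      have hfs : f * s ∉ p := fun h => (hp.mem_or_mem h).elim hfp hsp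
      obtain ⟨P, hP, hpP, hfP, hdP⟩ := avoid p hd hfs (Ideal.mul_mem_left _ _ (ha hs))
      have hPp : ¬ P ≤ p := fun h => by
        rw [le_antisymm h hpP, hd] at hdP
        have : n + 1 + 1 = n + 1 := by exact_mod_cast hdP
        omega
      have hJP : ¬ J * P ≤ p := fun h => (hp.mul_le.1 h).elim hJ hPp
      have heq : F (J * P) = F J := by
        have hle : F (J * P) ≤ F J := Submodule.smul_mono_left Ideal.mul_le_left
        by_contra hne
        exact hmin _ ⟨_, hJP, rfl⟩ (lt_of_le_of_ne hle hne)
      have hmP : maximalIdeal R ≤ (a ⊔ P).radical := hm.trans (Ideal.radical_mono (sup_le_sup_left hpP _))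
      refine hfP (ann_eq P hdP.le (ih P hP hmP hdP) _ fun z => ?_)
      obtain ⟨w, rfl⟩ := hsurj P hpP z
      rw [← map_smul]
      have h1 : (f * s) • w ∈ F J := Submodule.smul_mem_smul (Ideal.mul_mem_right _ _ hfJ) trivial
      rw [← heq] at h1
      have h2 : (f * s) • w ∈ P • (⊤ : Submodule R (LH a (n+1) (R ⧸ p))) := 
        (Submodule.smul_mono_left Ideal.mul_le_right : F (J * P) ≤ P • ⊤) h1
      have h3 : P • (⊤ : Submodule R (LH a (n+1) (R ⧸ p))) ≤ LinearMap.ker (lm a (n+1) (Submodule.factor hpP : (R ⧸ p) →ₗ[R] (R ⧸ P))) := by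
        rw [Submodule.smul_le]
        intro r hr y _
        rw [LinearMap.mem_ker, map_smul]
        exact LH_kill (by rw [Ideal.annihilator_quotient]; exact hr) _
      exact h3 h2
end


section
open TensorProduct

lemma exists_functional (p : Ideal R) [hp : p.IsPrime] (M : Type u) [AddCommGroup M] [Module R M] [Module.Finite R M] 
    (h : Module.annihilator R M ≤ p) : ∃ φ : M →ₗ[R] (R ⧸ p), φ ≠ 0 := by
  have hs : (⟨p, hp⟩ : PrimeSpectrum R) ∈ Module.support R M := by
    rw [Module.mem_support_iff_of_finite]; exact h
  rw [Module.mem_support_iff_nontrivial_residueField_tensorProduct] at hs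
  change Nontrivial (p.ResidueField ⊗[R] M) at hs
  obtain ⟨v, hv⟩ := exists_ne (0 : p.ResidueField ⊗[R] M)
  obtain ⟨g, hg⟩ : ∃ g : (p.ResidueField ⊗[R] M) →ₗ[p.ResidueField] p.ResidueField, g v ≠ 0 := by
    by_contra! hcon
    exact hv ((Module.forall_dual_apply_eq_zero_iff p.ResidueField v).1 hcon)
  let ψ : M →ₗ[R] p.ResidueField := (g.restrictScalars R) ∘ₗ (TensorProduct.mk R p.ResidueField M 1)
  obtain ⟨m, hm⟩ : ∃ m, ψ m ≠ 0 := by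
    by_contra! hcon
    apply hg
    induction v using TensorProduct.induction_on with
    | zero => simp
    | tmul c m => 
      have : c ⊗ₜ[R] m = c • ((1 : p.ResidueField) ⊗ₜ[R] m) := by simp [TensorProduct.smul_tmul']
      rw [this, map_smul]
      have : g ((1 : p.ResidueField) ⊗ₜ[R] m) = 0 := hcon m
      rw [this, smul_zero]
    | add x y hx hy => 
      rw [map_add]
      by_cases hx0 : g x = 0
      · by_cases hy0 : g y = 0
        · rw [hx0, hy0, add_zero]
        · exact absurd (hy (fun h => hy0 (by rw [h, map_zero])) hy0) hy0
      · exact absurd (hx (fun h => hx0 (by rw [h, map_zero])) hx0) hx0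
  obtain ⟨S, hS⟩ := Module.Finite.fg_top (R := R) (M := M)
  obtain ⟨b, hb⟩ := IsLocalization.exist_integer_multiples (nonZeroDivisors (R ⧸ p)) S (fun m => (ψ m : p.ResidueField))
  obtain ⟨c, hc⟩ := Ideal.Quotient.mk_surjective (b : R ⧸ p)
  let ι : (R ⧸ p) →ₗ[R] p.ResidueField := (IsScalarTower.toAlgHom R (R ⧸ p) p.ResidueField).toLinearMap
  have hι : Function.Injective ι := IsFractionRing.injective (R ⧸ p) p.ResidueField
  have hcs : ∀ y : p.ResidueField, c • y = (b : R ⧸ p) • y := fun y => by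
    rw [← hc, Algebra.smul_def, Algebra.smul_def]; rfl
  have hrange : ∀ m, (c • ψ) m ∈ LinearMap.range ι := by
    intro m
    have : m ∈ Submodule.span R (S : Set M) := by rw [hS]; trivial
    induction this using Submodule.span_induction with
    | mem x hx => 
      obtain ⟨y, hy⟩ := hb x hx
      refine ⟨y, ?_⟩
      rw [LinearMap.smul_apply, hcs]
      exact hy
    | zero => rw [map_zero]; exact zero_mem _
    | add x y _ _ hx hy => rw [map_add]; exact add_mem hx hy
    | smul r x _ hx => rw [map_smul]; exact Submodule.smul_mem _ _ hx
  let e := LinearEquiv.ofInjective ι hι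
  refine ⟨e.symm.toLinearMap ∘ₗ (c • ψ).codRestrict _ hrange, fun h0 => ?_⟩
  have h1 : e.symm (((c • ψ).codRestrict _ hrange) m) = 0 := congr($h0 m)
  rw [LinearEquiv.map_eq_zero_iff] at h1
  have h2 : c • ψ m = 0 := congr(($h1 : p.ResidueField))
  rw [hcs, Algebra.smul_def, mul_eq_zero] at h2
  rcases h2 with h2 | h2
  · have : (b : R ⧸ p) = 0 := hι (h2.trans (map_zero ι).symm)
    exact nonZeroDivisors.coe_ne_zero b this
  · exact hm h2
end

section
variable [IsNoetherianRing R] [IsLocalRing R]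
open IsLocalRing

lemma choose_list (d : ℕ) : ∀ (S : Set (Ideal R)) (_ : S.Finite) (_ : ∀ I ∈ S, ringKrullDim (R ⧸ I) ≤ (d : WithBot ℕ∞)),
    ∃ l : List R, l.length = d ∧ (∀ x ∈ l, x ∈ maximalIdeal R) ∧ ∀ I ∈ S, maximalIdeal R ≤ (Ideal.ofList l ⊔ I).radical := by
  induction d with
  | zero =>
    intro S _ hS
    refine ⟨[], rfl, by simp, fun I hI => ?_⟩
    rw [Ideal.radical_eq_sInf]
    refine le_sInf ?_
    rintro P ⟨hIP, hP⟩
    intro x hx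
    by_contra hxP
    have hd := (dim_mono (le_sup_right.trans hIP)).trans (hS I hI)
    have := dim_lt (P := P) (le_maximalIdeal hP.ne_top) hxP hx (k := 0) (hd.trans_lt (by exact_mod_cast Nat.zero_lt_one))
    rw [dim_max] at this
    exact lt_irrefl _ this
  | succ d ih =>
    intro S hfin hS
    let B : Set (Ideal R) := (⋃ I ∈ S, I.minimalPrimes) \ {maximalIdeal R}
    have hB : B.Finite := (hfin.biUnion fun I _ => I.finite_minimalPrimes_of_isNoetherianRing).sdiff
    have hBp : ∀ Q ∈ B, Q.IsPrime := by
      rintro Q ⟨hQ, -⟩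
      simp only [Set.mem_iUnion] at hQ
      obtain ⟨I, -, hQ⟩ := hQ
      exact hQ.1.1
    obtain ⟨x, hx, hxP⟩ : ∃ x ∈ maximalIdeal R, ∀ Q ∈ B, x ∉ Q := by
      by_contra! hcon
      have := (Ideal.subset_union_prime_finite hB (f := id) (I := maximalIdeal R) 0 0 
        (fun Q hQ _ _ => hBp Q hQ)).1 (fun x hx => by
          obtain ⟨Q, hQ, hxQ⟩ := hcon x hx
          exact Set.mem_biUnion hQ hxQ)
      obtain ⟨Q, hQ, hle⟩ := this
      exact hQ.2 (le_antisymm (le_maximalIdeal (hBp Q hQ).ne_top) hle)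
    obtain ⟨l, hl, hlm, hlS⟩ := ih ((fun I => I ⊔ Ideal.span {x}) '' S) (hfin.image _) (by
      rintro _ ⟨I, hI, rfl⟩
      by_contra! hlt
      have hlt' : ((d + 1 : ℕ) : WithBot ℕ∞) ≤ ringKrullDim (R ⧸ (I ⊔ Ideal.span {x})) := by
        by_contra! h
        exact absurd (hlt.trans_le (ENat.WithBot.lt_add_one_iff.1 (by exact_mod_cast h))) (lt_irrefl _)
      obtain ⟨P, hP, hle, hdP⟩ := exists_prime_dim _ hlt'
      obtain ⟨Q, hQ, hQP⟩ := Ideal.exists_minimalPrimes_le (le_sup_left.trans hle : I ≤ P)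
      have := hQ.1.1
      have hxinP : x ∈ P := hle (Ideal.mem_sup_right (Ideal.mem_span_singleton_self x))
      have hxQ : x ∉ Q := by
        refine hxP Q ⟨Set.mem_biUnion hI hQ, ?_⟩
        rintro rfl
        have : P = maximalIdeal R := le_antisymm (le_maximalIdeal hP.ne_top) hQP
        rw [this, dim_max] at hdP
        have : d + 1 ≤ 0 := by exact_mod_cast hdP
        omega
      have h4 := dim_lt (P := Q) hQP hxQ hxinP (k := d + 1) 
        (((dim_mono hQ.1.2).trans (hS I hI)).trans_lt (by exact_mod_cast Nat.lt_succ_self _))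
      exact absurd (hdP.trans_lt h4) (lt_irrefl _))
    refine ⟨x :: l, by simp [hl], by simpa using ⟨hx, hlm⟩, fun I hI => ?_⟩
    refine (hlS _ ⟨I, hI, rfl⟩).trans (Ideal.radical_mono ?_)
    rw [Ideal.ofList_cons]
    refine sup_le (le_sup_right.trans le_sup_left) (sup_le le_sup_right (le_sup_left.trans le_sup_left))
end


section
variable {a : Ideal R} {n : ℕ} [IsNoetherianRing R]

lemma dim_lt' {p : Ideal R} [p.IsPrime] {I : Ideal R} (h : p ≤ I) (h' : ¬ I ≤ p) 
    (hd : ringKrullDim (R ⧸ p) ≤ (n : WithBot ℕ∞)) : ringKrullDim (R ⧸ I) < (n : WithBot ℕ∞) := by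
  obtain ⟨x, hx, hxp⟩ := SetLike.not_le_iff_exists.1 h'
  exact dim_lt h hxp hx (hd.trans_lt (by exact_mod_cast Nat.lt_succ_self _))

lemma smul_top_of_van (M : Type u) [AddCommGroup M] [Module R M] [Module.Finite R M] 
    (hd : ringKrullDim (R ⧸ Module.annihilator R M) = (n : WithBot ℕ∞)) (p : Ideal R) 
    (hv : Van a n (M ⧸ (p • ⊤ : Submodule R M))) (z : LH a n M) : z ∈ p • (⊤ : Submodule R (LH a n M)) := by
  obtain ⟨S, hS⟩ := IsNoetherian.noetherian p
  let φ : (S → M) →ₗ[R] M := ∑ i : S, (i : R) • LinearMap.proj i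
  have hφ : ∀ v, φ v = ∑ i : S, (i : R) • v i := fun v => by simp [φ]
  have hr : LinearMap.range φ = p • ⊤ := by
    apply le_antisymm
    · rintro _ ⟨v, rfl⟩
      rw [hφ]
      refine sum_mem fun i _ => Submodule.smul_mem_smul ?_ trivial
      rw [← hS]
      exact Submodule.subset_span i.2
    · rw [← hS, Submodule.span_smul_eq, Submodule.set_smul_le_iff]
      intro r m hr _
      classical
      refine ⟨Pi.single ⟨r, hr⟩ m, ?_⟩
      rw [hφ, Finset.sum_eq_single ⟨r, hr⟩]
      · simp
      · intro b _ hb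
        rw [Pi.single_eq_of_ne hb, smul_zero]
      · simp
  have hann : Module.annihilator R M ≤ Module.annihilator R (LinearMap.ker φ) := by
    intro r hr
    rw [Module.mem_annihilator] at hr ⊢
    intro v
    apply Subtype.ext
    funext i
    exact hr _
  have h1 : Van a (n+1) (LinearMap.ker φ) := groth (n+1) _ (by rw [hd]; exact_mod_cast Nat.lt_succ_self _) _ hann
  have h2 : Van a n (M ⧸ LinearMap.range φ) := by rw [hr]; exact hv
  obtain ⟨w, rfl⟩ := lm_surj_gen φ h1 h2 z
  rw [lm_sum]
  refine sum_mem fun i _ => ?_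
  have : (i : R) • (LinearMap.proj i : (S → M) →ₗ[R] M) = ((i : R) • LinearMap.id) ∘ₗ LinearMap.proj i := rfl
  rw [this, lm_comp, lm_smul]
  refine Submodule.smul_mem_smul ?_ trivial
  rw [← hS]
  exact Submodule.subset_span i.2

lemma att_dim (M : Type u) [AddCommGroup M] [Module R M] [Module.Finite R M] 
    (hd : ringKrullDim (R ⧸ Module.annihilator R M) = (n : WithBot ℕ∞)) (p : Ideal R) [hp : p.IsPrime] 
    (K : Submodule R (LH a n M)) (hK : p = Module.annihilator R (LH a n M ⧸ K)) : 
    ringKrullDim (R ⧸ p) = (n : WithBot ℕ∞) ∧ p ∈ associatedPrimes R M ∧ ¬ Van a n (M ⧸ (p • ⊤ : Submodule R M)) := by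
  have hnv : ¬ Van a n (M ⧸ (p • ⊤ : Submodule R M)) := by
    intro hv
    have hle : p • (⊤ : Submodule R (LH a n M)) ≤ K := by
      rw [Submodule.smul_le]
      intro r hr z _
      rw [hK, Module.mem_annihilator] at hr
      exact (Submodule.Quotient.mk_eq_zero _).1 (hr (Submodule.Quotient.mk z))
    apply hp.ne_top
    rw [hK, Module.annihilator_eq_top_iff, Submodule.Quotient.subsingleton_iff, eq_top_iff]
    intro z _
    exact hle (smul_top_of_van M hd p hv z)
  have hMp : Module.annihilator R M ≤ p := by
    intro r hr
    rw [hK, Module.mem_annihilator]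
    intro z
    obtain ⟨z, rfl⟩ := Submodule.mkQ_surjective _ z
    rw [← map_smul, LH_kill hr, map_zero]
  have hdp : ringKrullDim (R ⧸ p) = (n : WithBot ℕ∞) := by
    apply le_antisymm ((dim_mono hMp).trans hd.le)
    by_contra! hlt
    refine hnv (groth n p hlt _ ?_)
    intro r hr
    rw [Module.mem_annihilator]
    intro z
    obtain ⟨z, rfl⟩ := Submodule.mkQ_surjective _ z
    rw [← map_smul]
    exact (Submodule.Quotient.mk_eq_zero _).2 (Submodule.smul_mem_smul hr trivial)
  refine ⟨hdp, ?_, hnv⟩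
  apply Module.associatedPrimes.minimalPrimes_annihilator_subset_associatedPrimes R M
  refine ⟨⟨hp, hMp⟩, ?_⟩
  rintro Q ⟨hQ, hMQ⟩ hQp
  by_contra hpQ
  have := dim_lt' (p := Q) hQp hpQ ((dim_mono hMQ).trans hd.le)
  exact absurd (hdp ▸ this) (lt_irrefl _)

lemma mem_att (M : Type u) [AddCommGroup M] [Module R M] [Module.Finite R M] 
    (hd : ringKrullDim (R ⧸ Module.annihilator R M) = (n : WithBot ℕ∞)) (p : Ideal R) [hp : p.IsPrime] 
    (hdp : ringKrullDim (R ⧸ p) = (n : WithBot ℕ∞)) (hMp : Module.annihilator R M ≤ p) (hv : ¬ Van a n (R ⧸ p)) : 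
    ∃ K : Submodule R (LH a n M), p = Module.annihilator R (LH a n M ⧸ K) := by
  obtain ⟨φ, hφ⟩ := exists_functional p M hMp
  obtain ⟨m, hm⟩ : ∃ m, φ m ≠ 0 := by
    by_contra! h
    exact hφ (LinearMap.ext h)
  have h1 : Van a (n+1) (LinearMap.ker φ) := groth (n+1) _ (by rw [hd]; exact_mod_cast Nat.lt_succ_self _) _ 
    (LinearMap.annihilator_le_of_injective (Submodule.subtype _) Subtype.val_injective)
  have h2 : Van a n ((R ⧸ p) ⧸ LinearMap.range φ) := by
    refine groth n (Module.annihilator R ((R ⧸ p) ⧸ LinearMap.range φ)) ?_ _ le_rfl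
    refine dim_lt' (p := p) ?_ ?_ hdp.le
    · exact (le_of_eq Ideal.annihilator_quotient.symm).trans 
        (LinearMap.annihilator_le_of_surjective (Submodule.mkQ _) (Submodule.mkQ_surjective _))
    · intro hle
      obtain ⟨c, hc⟩ := Ideal.Quotient.mk_surjective (φ m)
      apply hm
      rw [← hc, Ideal.Quotient.eq_zero_iff_mem]
      apply hle
      rw [Module.mem_annihilator]
      intro z
      obtain ⟨z, rfl⟩ := Submodule.mkQ_surjective _ z
      obtain ⟨z, rfl⟩ := Ideal.Quotient.mk_surjective z
      rw [← map_smul]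
      refine (Submodule.Quotient.mk_eq_zero _).2 ⟨z • m, ?_⟩
      rw [map_smul, ← hc]
      change Ideal.Quotient.mk p (z * c) = Ideal.Quotient.mk p (c * z)
      rw [mul_comm]
  have hs := lm_surj_gen φ h1 h2
  refine ⟨LinearMap.ker (lm a n φ), ?_⟩
  rw [((lm a n φ).quotKerEquivOfSurjective hs).annihilator_eq]
  apply le_antisymm
  · intro r hr
    rw [Module.mem_annihilator]
    intro z
    exact LH_kill (by rw [Ideal.annihilator_quotient]; exact hr) z
  · intro r hr
    exact ann_eq p hdp.le hv r (Module.mem_annihilator.1 hr)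

variable [IsLocalRing R]
open IsLocalRing

lemma main (M : Type u) [AddCommGroup M] [Module R M] [Module.Finite R M] (hn : 2 ≤ n)
    (hd : ringKrullDim (R ⧸ Module.annihilator R M) = (n : WithBot ℕ∞)) (T : Set (Ideal R)) (q : Ideal R) 
    (hTA : ∀ p ∈ T, p ∈ associatedPrimes R M) (hTd : ∀ p ∈ T, ringKrullDim (R ⧸ p) = (n : WithBot ℕ∞))
    (hq : q.IsPrime) (hqd : ringKrullDim (R ⧸ q) = (n : WithBot ℕ∞)) (hqT : q ∉ T) 
    (hT : ∀ p ∈ associatedPrimes R M, ringKrullDim (R ⧸ p) = (n : WithBot ℕ∞) → p ≠ q → p ∈ T) : 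
    ∃ a : Ideal R, ∀ p : Ideal R, (p.IsPrime ∧ ∃ K : Submodule R (LH a n M), p = Module.annihilator R (LH a n M ⧸ K)) ↔ 
      p ∈ T := by
  have hTp : ∀ p ∈ T, p.IsPrime := fun p hp => (hTA p hp).isPrime
  have hTf : T.Finite := (associatedPrimes.finite R M).subset hTA
  obtain ⟨z, hz, hzT⟩ : ∃ z ∈ q, ∀ p ∈ T, z ∉ p := by
    by_contra! hcon
    have := (Ideal.subset_union_prime_finite hTf (f := id) (I := q) 0 0 
      (fun Q hQ _ _ => hTp Q hQ)).1 (fun x hx => by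
        obtain ⟨Q, hQ, hxQ⟩ := hcon x hx
        exact Set.mem_biUnion hQ hxQ)
    obtain ⟨Q, hQ, hle⟩ := this
    change q ≤ Q at hle
    by_cases h : Q ≤ q
    · exact hqT (le_antisymm hle h ▸ hQ)
    · have := dim_lt' hle h hqd.le
      exact absurd (hTd Q hQ ▸ this) (lt_irrefl _)
  obtain ⟨k, rfl⟩ : ∃ k, n = k + 1 := ⟨n - 1, by omega⟩
  obtain ⟨l, hl, hlm, hlS⟩ := choose_list k ((fun I => I ⊔ Ideal.span {z}) '' T) (hTf.image _) (by
    rintro _ ⟨p, hp, rfl⟩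
    have := hTp p hp
    have := dim_lt' (p := p) (I := p ⊔ Ideal.span {z}) le_sup_left 
      (fun h => hzT p hp (h (Ideal.mem_sup_right (Ideal.mem_span_singleton_self z)))) (hTd p hp).le
    exact ENat.WithBot.lt_add_one_iff.1 (by exact_mod_cast this))
  let a : Ideal R := Ideal.ofList l ⊔ Ideal.span {z}
  have ham : a ≤ maximalIdeal R := by
    refine sup_le (Ideal.span_le.2 fun x hx => hlm x hx) ?_
    rw [Ideal.span_singleton_le_iff_mem]
    exact le_maximalIdeal hq.ne_top hz
  refine ⟨a, fun p => ⟨?_, fun hp => ?_⟩⟩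
  · rintro ⟨hp, K, hK⟩
    obtain ⟨h1, h2, h3⟩ := att_dim M hd p K hK
    refine hT p h2 h1 ?_
    rintro rfl
    refine h3 (van_gens l (fun x hx => Ideal.mem_sup_left (Ideal.subset_span hx)) p ?_ (k+1) (by omega) _ ?_)
    · refine le_trans (sup_le_sup_left ?_ _) Ideal.le_radical
      rw [Ideal.span_singleton_le_iff_mem]
      exact hz
    · intro r hr
      rw [Module.mem_annihilator]
      intro z
      obtain ⟨z, rfl⟩ := Submodule.mkQ_surjective _ z
      rw [← map_smul]
      exact (Submodule.Quotient.mk_eq_zero _).2 (Submodule.smul_mem_smul hr trivial)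
  · have hpp := hTp p hp
    refine ⟨hpp, mem_att M hd p (hTd p hp) ?_ (nonvan ham _ p hpp ?_ (hTd p hp))⟩
    · rw [← Submodule.annihilator_top]; exact (hTA p hp).annihilator_le
    · refine (hlS _ ⟨p, hp, rfl⟩).trans (Ideal.radical_mono ?_)
      exact sup_le (le_sup_left.trans le_sup_left) (sup_le le_sup_right (le_sup_right.trans le_sup_left))
end

end LC

theorem stmt7 (R : Type u) [CommRing R] [IsNoetherianRing R] [IsLocalRing R]
    [IsAdicComplete (IsLocalRing.maximalIdeal R) R]
    (M : Type u) [AddCommGroup M] [Module R M] [Module.Finite R M]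
    (n : ℕ) (hn : 2 ≤ n)
    (hdim : ringKrullDim (R ⧸ Module.annihilator R M) = (n : WithBot (WithTop ℕ)))
    (T : Set (Ideal R)) (hT : T ⊆ assh R M n) (hTne : T.Nonempty)
    (hcompl : ∃ q : Ideal R, assh R M n \ T = {q}) :
    ∃ a : Ideal R,
      attachedPrimes R ((localCohomology a n).obj (ModuleCat.of R M)) = T := by
  obtain ⟨q, hq⟩ := hcompl
  have hq' : q ∈ assh R M n \ T := by rw [hq]; rfl
  obtain ⟨a, ha⟩ := LC.main M hn hdim T q (fun p hp => (hT hp).1) (fun p hp => (hT hp).2)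
    hq'.1.1.isPrime hq'.1.2 hq'.2
    (fun p h1 h2 hne => by
      by_contra h3
      have : p ∈ assh R M n \ T := ⟨⟨h1, h2⟩, h3⟩
      rw [hq] at this
      exact hne this)
  exact ⟨a, Set.ext ha⟩

end
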